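/- Let d ≥ 5 and let k ≥ 2 be an integer. Let R_∞^1, …, R_∞^k be the ranges of k independent simple random walks on ℤ^d started at 0. Then there exist positive constants c₁ and c₂ such that for every t > 1: exp(−c₁·t^{1−2/d}) ≤ ℙ(|R_∞^1 ∩ ⋯ ∩ R_∞^k| > t) ≤ exp(−c₂·t^{1−2/d}). -/

import Mathlib

open MeasureTheory Set
open scoped Classical ENNReal

noncomputable section

/-- The statement `|S| > t`, allowing for infinite sets. -/
def BigCard {α : Type*} (S : Set α) (t : ℝ) : Prop :=
  S.Infinite ∨ t < (S.ncard : ℝ)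

/-- The range `{S_n : n ≥ 0}` of the walk with steps `X 0, X 1, …`. -/
def walkRange {Ω : Type*} {d : ℕ} (X : ℕ → Ω → (Fin d → ℤ)) (ω : Ω) :
    Set (Fin d → ℤ) :=
  {y | ∃ n : ℕ, ∑ m ∈ Finset.range n, X m ω = y}

namespace SRW

/-! ### Heat kernel of the simple random walk -/

/-- The unit steps, indexed by a direction and a sign. -/
abbrev Step (d : ℕ) : Type := Fin d × Bool

/-- The unit vector of a step. -/
def vec {d : ℕ} (e : Step d) : Fin d → ℤ := Pi.single e.1 (if e.2 then 1 else -1)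

/-- One-step average of a function on the lattice. -/
def mean {d : ℕ} (f : (Fin d → ℤ) → ℝ) (x : Fin d → ℤ) : ℝ :=
  (∑ e : Step d, f (x + vec e)) / (2 * d)

/-- The probability that the walk started at `x` is at the origin after `n` steps. -/
def heat {d : ℕ} : ℕ → (Fin d → ℤ) → ℝ
  | 0 => fun x => if x = 0 then 1 else 0
  | n + 1 => mean (heat n)

theorem centralBinom_sq_mul_le (m : ℕ) : m.centralBinom ^ 2 * (2 * m + 1) ≤ 16 ^ m := by
  induction m with
  | zero => simp
  | succ m ih =>
    have h := Nat.succ_mul_centralBinom_succ m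
    have h2 : (m + 1) ^ 2 * ((m + 1).centralBinom ^ 2 * (2 * (m + 1) + 1))
        = 4 * ((2 * m + 1) * (2 * m + 3)) * (m.centralBinom ^ 2 * (2 * m + 1)) := by
      calc _ = ((m + 1) * (m + 1).centralBinom) ^ 2 * (2 * (m + 1) + 1) := by ring
        _ = _ := by rw [h]; ring
    have h3 : (m + 1) ^ 2 * ((m + 1).centralBinom ^ 2 * (2 * (m + 1) + 1))
        ≤ (m + 1) ^ 2 * 16 ^ (m + 1) := by
      rw [h2]
      calc _ ≤ 4 * (4 * (m + 1) ^ 2) * 16 ^ m := by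
            refine Nat.mul_le_mul (Nat.mul_le_mul_left _ ?_) ih
            nlinarith
        _ = _ := by ring
    exact Nat.le_of_mul_le_mul_left h3 (by positivity)

theorem choose_middle_sq_mul_le (k : ℕ) : (k.choose (k / 2)) ^ 2 * (k + 1) ≤ 4 ^ k := by
  rcases Nat.even_or_odd' k with ⟨m, rfl | rfl⟩
  · have h := centralBinom_sq_mul_le m
    rw [Nat.mul_div_cancel_left _ (by norm_num), pow_mul]
    simpa [Nat.centralBinom] using h
  · have h := centralBinom_sq_mul_le (m + 1)
    have h1 : (2 * m + 1) / 2 = m := by omega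
    have h2 : (m + 1).centralBinom = 2 * (2 * m + 1).choose m := by
      rw [Nat.centralBinom_eq_two_mul_choose]
      have : 2 * (m + 1) = 2 * m + 1 + 1 := by ring
      rw [this, Nat.choose_succ_succ, Nat.choose_symm_half]
      ring
    rw [h1]
    rw [h2] at h
    have h3 : (16 : ℕ) ^ (m + 1) = 4 * 4 ^ (2 * m + 1) := by
      rw [pow_succ, pow_succ, pow_mul]; norm_num; ring
    rw [h3] at h
    nlinarith [sq_nonneg ((2 * m + 1).choose m)]

theorem choose_div_two_pow_le (k j : ℕ) :
    (k.choose j : ℝ) / 2 ^ k ≤ Real.sqrt (1 / (k + 1)) := by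
  apply Real.le_sqrt_of_sq_le
  rw [div_pow, div_le_div_iff₀ (by positivity) (by positivity), one_mul]
  have h1 : (k.choose j : ℝ) ≤ k.choose (k / 2) := by exact_mod_cast Nat.choose_le_middle j k
  have h2 : ((k.choose (k / 2)) ^ 2 * (k + 1) : ℝ) ≤ 4 ^ k := by
    exact_mod_cast choose_middle_sq_mul_le k
  calc (k.choose j : ℝ) ^ 2 * (k + 1) ≤ (k.choose (k / 2)) ^ 2 * (k + 1) := by gcongr
    _ ≤ 4 ^ k := h2
    _ = (2 ^ k) ^ 2 := by rw [← pow_mul, mul_comm k 2, pow_mul]; norm_num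

/-- The generating element of the steps in direction `i`. -/
def dirGen {d : ℕ} (i : Fin d) : AddMonoidAlgebra ℝ (Fin d → ℤ) :=
  AddMonoidAlgebra.single (Pi.single i 1) (1 / 2) +
    AddMonoidAlgebra.single (Pi.single i (-1)) (1 / 2)

theorem heat_eq_coeff {d : ℕ} (n : ℕ) (x : Fin d → ℤ) :
    heat n x = ((∑ i : Fin d, dirGen i) ^ n).coeff x / (d : ℝ) ^ n := by
  induction n generalizing x with
  | zero =>
    simp only [heat, pow_zero, div_one, AddMonoidAlgebra.one_def]
    rw [AddMonoidAlgebra.coeff_single, Finsupp.single_apply]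
    simp [eq_comm]
  | succ n ih =>
    have key : ((∑ i : Fin d, dirGen i) ^ (n + 1)).coeff x
        = (∑ e : Step d, ((∑ i : Fin d, dirGen i) ^ n).coeff (x + vec e)) / 2 := by
      rw [pow_succ', Finset.sum_mul, AddMonoidAlgebra.coeff_sum, Finset.sum_apply',
        Fintype.sum_prod_type, Finset.sum_div]
      refine Finset.sum_congr rfl fun i _ => ?_
      rw [dirGen, add_mul]
      simp [AddMonoidAlgebra.coeff_single_mul_apply, vec, add_comm, ← Pi.single_neg]
      ring
    rw [heat, mean, key]
    simp_rw [ih]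
    rw [← Finset.sum_div, div_div, div_div, pow_succ]
    congr 1
    ring

theorem coeff_prod_dirGen_le {d : ℕ} (k : Fin d → ℕ) (x : Fin d → ℤ) :
    (∏ i, dirGen i ^ k i).coeff x ≤ ∏ i, Real.sqrt (1 / (k i + 1)) := by
  have h1 : ∀ i : Fin d, dirGen i ^ k i = ∑ j ∈ Finset.range (k i + 1),
      AddMonoidAlgebra.single (Pi.single i (2 * (j : ℤ) - k i)) ((k i).choose j / 2 ^ k i : ℝ) := by
    intro i
    rw [dirGen, add_pow]
    refine Finset.sum_congr rfl fun j hj => ?_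
    have hj' : j ≤ k i := by simpa [Nat.lt_succ_iff] using hj
    rw [AddMonoidAlgebra.single_pow, AddMonoidAlgebra.single_pow,
      AddMonoidAlgebra.single_mul_single, AddMonoidAlgebra.natCast_def,
      AddMonoidAlgebra.single_mul_single]
    congr 1
    · ext a
      rcases eq_or_ne a i with rfl | h
      · simp [Nat.cast_sub hj']; ring
      · simp [h]
    · rw [← pow_add, Nat.add_sub_cancel' hj']
      simp [div_eq_mul_inv, mul_comm]
  have h2 : ∀ (s : Finset (Fin d)) (g : Fin d → Fin d → ℤ) (c : Fin d → ℝ),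
      ∏ i ∈ s, AddMonoidAlgebra.single (g i) (c i)
        = AddMonoidAlgebra.single (∑ i ∈ s, g i) (∏ i ∈ s, c i) := by
    intro s g c
    induction s using Finset.induction_on with
    | empty => simp [AddMonoidAlgebra.one_def]
    | insert a s ha ih =>
      rw [Finset.prod_insert ha, ih, AddMonoidAlgebra.single_mul_single, Finset.sum_insert ha,
        Finset.prod_insert ha]
  simp_rw [h1]
  rw [Finset.prod_univ_sum]
  simp_rw [h2]
  rw [AddMonoidAlgebra.coeff_sum, Finset.sum_apply']
  simp_rw [AddMonoidAlgebra.coeff_single, Finsupp.single_apply]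
  set T := Fintype.piFinset fun i => Finset.range (k i + 1)
  have hv : ∀ p : Fin d → ℕ, (∑ i, Pi.single i (2 * (p i : ℤ) - k i) : Fin d → ℤ)
      = fun i => 2 * (p i : ℤ) - k i := fun p => Finset.univ_sum_single _
  simp_rw [hv]
  by_cases hx : ∃ p : Fin d → ℕ, (fun i => 2 * (p i : ℤ) - k i) = x
  · obtain ⟨p, hp⟩ := hx
    have huniq : ∀ q : Fin d → ℕ, (fun i => 2 * (q i : ℤ) - k i) = x → q = p := by
      intro q hq
      ext i
      have := congrFun (hq.trans hp.symm) i
      omega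
    calc _ ≤ ∑ q ∈ T, if q = p then ∏ i, ((k i).choose (p i) / 2 ^ k i : ℝ) else 0 := by
          refine Finset.sum_le_sum fun q _ => ?_
          split_ifs with h h'
          · rw [h']
          · exact absurd (huniq q h) h'
          · positivity
          · exact le_rfl
      _ ≤ ∏ i, ((k i).choose (p i) / 2 ^ k i : ℝ) := by
          rw [Finset.sum_ite_eq']
          split_ifs
          · exact le_rfl
          · positivity
      _ ≤ _ := Finset.prod_le_prod (fun _ _ => by positivity)
          fun i _ => choose_div_two_pow_le _ _
  · push Not at hx
    rw [Finset.sum_eq_zero fun q _ => if_neg (hx q)]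
    positivity

theorem sum_multinomial_div_le (d n : ℕ) :
    ∑ k ∈ Finset.piAntidiag (Finset.univ : Finset (Fin d)) n,
      (Nat.multinomial Finset.univ k : ℝ) * ∏ i, (1 / (k i + 1) : ℝ)
      ≤ d ^ (n + d) / (n + 1) ^ d := by
  have h1 : ∀ k ∈ Finset.piAntidiag (Finset.univ : Finset (Fin d)) n,
      (Nat.multinomial Finset.univ k : ℝ) * ∏ i, (1 / (k i + 1) : ℝ)
      = Nat.multinomial Finset.univ (fun i => k i + 1) * (n.factorial / (n + d).factorial) := by
    intro k hk
    have hs : ∑ i, k i = n := (Finset.mem_piAntidiag.mp hk).1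
    have e1 : (Nat.multinomial Finset.univ k : ℝ) = n.factorial / ∏ i, ((k i).factorial : ℝ) := by
      rw [eq_div_iff (by positivity), mul_comm]
      have := Nat.multinomial_spec Finset.univ k
      rw [hs] at this
      exact_mod_cast this
    have e2 : (Nat.multinomial Finset.univ (fun i => k i + 1) : ℝ)
        = (n + d).factorial / ∏ i, ((k i + 1).factorial : ℝ) := by
      rw [eq_div_iff (by positivity), mul_comm]
      have := Nat.multinomial_spec Finset.univ (fun i => k i + 1)
      rw [Finset.sum_add_distrib, hs] at this
      simp only [Finset.sum_const, Finset.card_univ, Fintype.card_fin, smul_eq_mul, mul_one] at this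
      exact_mod_cast this
    rw [e1, e2]
    have e3 : ∏ i, ((k i + 1).factorial : ℝ)
        = (∏ i, ((k i : ℝ) + 1)) * ∏ i, ((k i).factorial : ℝ) := by
      rw [← Finset.prod_mul_distrib]
      refine Finset.prod_congr rfl fun i _ => ?_
      rw [Nat.factorial_succ]; push_cast; ring
    rw [e3, Finset.prod_div_distrib]
    have p1 : (∏ i, ((k i : ℝ) + 1)) ≠ 0 := by positivity
    have p2 : (∏ i, ((k i).factorial : ℝ)) ≠ 0 := by positivity
    have p3 : ((n + d).factorial : ℝ) ≠ 0 := by positivity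
    field_simp
    simp
  rw [Finset.sum_congr rfl h1, ← Finset.sum_mul]
  have h2 : ∑ k ∈ Finset.piAntidiag (Finset.univ : Finset (Fin d)) n,
      (Nat.multinomial Finset.univ (fun i => k i + 1) : ℝ) ≤ (d : ℝ) ^ (n + d) := by
    have hd : (d : ℝ) ^ (n + d) = ∑ k ∈ Finset.piAntidiag (Finset.univ : Finset (Fin d)) (n + d),
        (Nat.multinomial Finset.univ k : ℝ) := by
      have := Finset.sum_pow_eq_sum_piAntidiag (Finset.univ : Finset (Fin d))
        (fun _ => (1 : ℝ)) (n + d)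
      simpa using this
    rw [hd]
    have hinj : Set.InjOn (fun (k : Fin d → ℕ) i => k i + 1)
        (Finset.piAntidiag (Finset.univ : Finset (Fin d)) n : Set (Fin d → ℕ)) := by
      intro a _ b _ hab
      ext i
      have := congrFun hab i
      simpa using this
    rw [← Finset.sum_image (f := fun k => (Nat.multinomial Finset.univ k : ℝ)) hinj]
    refine Finset.sum_le_sum_of_subset_of_nonneg ?_ fun _ _ _ => by positivity
    intro q hq
    obtain ⟨k, hk, rfl⟩ := Finset.mem_image.mp hq
    have hs : ∑ i, k i = n := (Finset.mem_piAntidiag.mp hk).1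
    simp [Finset.sum_add_distrib, hs]
  have h3 : (n.factorial : ℝ) / (n + d).factorial ≤ 1 / (n + 1) ^ d := by
    rw [div_le_div_iff₀ (by positivity) (by positivity), one_mul]
    exact_mod_cast Nat.factorial_mul_pow_le_factorial
  calc _ ≤ (d : ℝ) ^ (n + d) * (1 / (n + 1) ^ d) := by gcongr
    _ = _ := by rw [mul_one_div]

/-- On-diagonal upper bound for the heat kernel, uniformly over the lattice. -/
theorem heat_le {d : ℕ} (hd : 0 < d) (n : ℕ) (x : Fin d → ℤ) :
    heat n x ≤ Real.sqrt (d ^ d) * Real.sqrt (1 / (n + 1) ^ d) := by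
  have hd' : (0 : ℝ) < d := by exact_mod_cast hd
  rw [heat_eq_coeff, div_le_iff₀ (by positivity), Finset.sum_pow_eq_sum_piAntidiag,
    AddMonoidAlgebra.coeff_sum, Finset.sum_apply']
  set T := Finset.piAntidiag (Finset.univ : Finset (Fin d)) n
  have hsum : ∑ k ∈ T, (Nat.multinomial Finset.univ k : ℝ) = (d : ℝ) ^ n := by
    have := Finset.sum_pow_eq_sum_piAntidiag (Finset.univ : Finset (Fin d)) (fun _ => (1 : ℝ)) n
    simpa using this.symm
  calc _ ≤ ∑ k ∈ T, (Nat.multinomial Finset.univ k : ℝ) * ∏ i, Real.sqrt (1 / (k i + 1)) := by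
        refine Finset.sum_le_sum fun k _ => ?_
        rw [← nsmul_eq_mul, AddMonoidAlgebra.coeff_smul, Finsupp.smul_apply, nsmul_eq_mul]
        gcongr
        exact coeff_prod_dirGen_le k x
    _ = ∑ k ∈ T, Real.sqrt (Nat.multinomial Finset.univ k) *
          Real.sqrt (Nat.multinomial Finset.univ k * ∏ i, (1 / (k i + 1) : ℝ)) := by
        refine Finset.sum_congr rfl fun k _ => ?_
        rw [Real.sqrt_mul (by positivity), ← mul_assoc, Real.mul_self_sqrt (by positivity),
          Real.sqrt_prod _ (fun _ _ => by positivity)]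
    _ ≤ Real.sqrt (∑ k ∈ T, (Nat.multinomial Finset.univ k : ℝ)) * Real.sqrt
          (∑ k ∈ T, (Nat.multinomial Finset.univ k : ℝ) * ∏ i, (1 / (k i + 1) : ℝ)) :=
        Real.sum_sqrt_mul_sqrt_le _ (fun _ => by positivity) (fun _ => by positivity)
    _ ≤ Real.sqrt (d ^ n) * Real.sqrt (d ^ (n + d) / (n + 1) ^ d) := by
        rw [hsum]
        gcongr
        exact sum_multinomial_div_le d n
    _ = _ := by
        rw [← Real.sqrt_mul (by positivity), ← Real.sqrt_mul (by positivity)]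
        have : (d : ℝ) ^ n = Real.sqrt (((d : ℝ) ^ n) ^ 2) := (Real.sqrt_sq (by positivity)).symm
        rw [this, ← Real.sqrt_mul (by positivity), ← this]
        congr 1
        ring

/-! ### Power sums -/

theorem rpow_neg_le_telescope {s a : ℝ} (hs : 1 < s) (ha : 1 ≤ a) :
    a ^ (-s) ≤ 2 ^ s / (s - 1) * (a ^ (1 - s) - (a + 1) ^ (1 - s)) := by
  have ha0 : 0 < a := by linarith
  have hs0 : 0 < s - 1 := by linarith
  have h1 : (s - 1) / (a + 1) ≤ Real.log (a + 1) * (s - 1) - Real.log a * (s - 1) := by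
    have := Real.log_le_sub_one_of_pos (show 0 < a / (a + 1) by positivity)
    rw [Real.log_div (by positivity) (by positivity)] at this
    have h2 : a / (a + 1) - 1 = - (1 / (a + 1)) := by field_simp; ring
    rw [h2] at this
    have : (s - 1) * (1 / (a + 1)) ≤ (s - 1) * (Real.log (a + 1) - Real.log a) := by
      gcongr; linarith
    calc (s - 1) / (a + 1) = (s - 1) * (1 / (a + 1)) := by ring
      _ ≤ _ := this
      _ = _ := by ring
  have h2 : (a + 1) ^ (1 - s) * (1 + (s - 1) / (a + 1)) ≤ a ^ (1 - s) := by
    rw [Real.rpow_def_of_pos (by linarith), Real.rpow_def_of_pos ha0]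
    calc _ ≤ Real.exp (Real.log (a + 1) * (1 - s)) * Real.exp
          (Real.log (a + 1) * (s - 1) - Real.log a * (s - 1)) := by
          gcongr
          have := Real.add_one_le_exp (Real.log (a + 1) * (s - 1) - Real.log a * (s - 1))
          linarith
      _ = _ := by rw [← Real.exp_add]; ring_nf
  have h3 : (a + 1) ^ (1 - s) * ((s - 1) / (a + 1)) = (s - 1) * (a + 1) ^ (-s) := by
    rw [show (1 - s) = -s + 1 by ring, Real.rpow_add_one (by positivity)]
    field_simp
  have h4 : a ^ (-s) ≤ 2 ^ s * (a + 1) ^ (-s) := by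
    rw [Real.rpow_neg ha0.le, Real.rpow_neg (by positivity), ← div_eq_mul_inv, ← one_div,
      div_le_div_iff₀ (by positivity) (by positivity), one_mul,
      ← Real.mul_rpow (by norm_num) ha0.le]
    exact Real.rpow_le_rpow (by positivity) (by linarith) (by linarith)
  calc a ^ (-s) ≤ 2 ^ s * (a + 1) ^ (-s) := h4
    _ = 2 ^ s / (s - 1) * ((s - 1) * (a + 1) ^ (-s)) := by field_simp
    _ ≤ _ := by
      gcongr
      rw [← h3]
      linarith

/-- The constant in the tail bound for power sums. -/
def tailConst (s : ℝ) : ℝ := 2 ^ s / (s - 1)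

theorem tailConst_pos {s : ℝ} (hs : 1 < s) : 0 < tailConst s :=
  div_pos (Real.rpow_pos_of_pos (by norm_num) _) (by linarith)

theorem sum_rpow_neg_le {s : ℝ} (hs : 1 < s) {T : ℕ} (hT : 1 ≤ T) (n : ℕ) :
    ∑ i ∈ Finset.range n, ((i : ℝ) + T) ^ (-s) ≤ tailConst s * (T : ℝ) ^ (1 - s) := by
  have hT' : (1 : ℝ) ≤ T := by exact_mod_cast hT
  calc _ ≤ ∑ i ∈ Finset.range n, tailConst s *
        (((i : ℝ) + T) ^ (1 - s) - (((i + 1 : ℕ) : ℝ) + T) ^ (1 - s)) := by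
        refine Finset.sum_le_sum fun i _ => ?_
        have h0 : (0 : ℝ) ≤ i := by positivity
        have e : ((i + 1 : ℕ) : ℝ) + T = (i : ℝ) + T + 1 := by push_cast; ring
        rw [e]
        exact rpow_neg_le_telescope hs (by linarith)
    _ = tailConst s * ((T : ℝ) ^ (1 - s) - ((n : ℝ) + T) ^ (1 - s)) := by
        rw [← Finset.mul_sum, Finset.sum_range_sub' (fun i : ℕ => ((i : ℝ) + T) ^ (1 - s))]
        simp
    _ ≤ _ := by
        have := tailConst_pos hs
        gcongr
        have : (0 : ℝ) ≤ ((n : ℝ) + T) ^ (1 - s) := by positivity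
        linarith

/-! ### The averaging operator and the heat kernel -/

variable {d : ℕ}

theorem mean_mono {f g : (Fin d → ℤ) → ℝ} {x : Fin d → ℤ} (h : ∀ y, f y ≤ g y) :
    mean f x ≤ mean g x := by
  unfold mean
  gcongr
  exact h _

theorem mean_const (hd : 0 < d) (c : ℝ) (x : Fin d → ℤ) : mean (fun _ => c) x = c := by
  have : (d : ℝ) ≠ 0 := by positivity
  simp [mean]
  field_simp

theorem mean_const_mul (c : ℝ) (f : (Fin d → ℤ) → ℝ) (x : Fin d → ℤ) :
    mean (fun y => c * f y) x = c * mean f x := by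
  simp only [mean, ← Finset.mul_sum, mul_div_assoc]

theorem mean_sum {ι : Type*} (s : Finset ι) (f : ι → (Fin d → ℤ) → ℝ) (x : Fin d → ℤ) :
    mean (fun y => ∑ i ∈ s, f i y) x = ∑ i ∈ s, mean (f i) x := by
  simp only [mean]
  rw [Finset.sum_comm, Finset.sum_div]

theorem mean_tsum {f : ℕ → (Fin d → ℤ) → ℝ} (hf : ∀ y, Summable fun m => f m y)
    (x : Fin d → ℤ) : mean (fun y => ∑' m, f m y) x = ∑' m, mean (f m) x := by
  simp only [mean]
  rw [tsum_div_const, Summable.tsum_finsetSum fun e _ => hf _]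

theorem mean_shift (f : (Fin d → ℤ) → ℝ) (z x : Fin d → ℤ) :
    mean (fun y => f (y - z)) x = mean f (x - z) := by
  simp only [mean]
  congr 1
  refine Finset.sum_congr rfl fun e _ => ?_
  congr 1
  abel

theorem vec_flip (e : Step d) : vec (e.1, !e.2) = -vec e := by
  obtain ⟨i, b⟩ := e
  cases b <;> simp [vec, ← Pi.single_neg]

theorem mean_neg (f : (Fin d → ℤ) → ℝ) (hf : ∀ y, f (-y) = f y) (x : Fin d → ℤ) :
    mean f (-x) = mean f x := by
  simp only [mean]
  congr 1
  refine Fintype.sum_equiv ((Equiv.refl _).prodCongr Equiv.boolNot) _ _ fun e => ?_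
  have : ((Equiv.refl (Fin d)).prodCongr Equiv.boolNot) e = (e.1, !e.2) := rfl
  rw [this, vec_flip, ← hf]
  congr 1
  abel

theorem heat_nonneg (n : ℕ) (x : Fin d → ℤ) : 0 ≤ heat n x := by
  induction n generalizing x with
  | zero => simp only [heat]; split_ifs <;> norm_num
  | succ n ih => exact div_nonneg (Finset.sum_nonneg fun e _ => ih _) (by positivity)

theorem heat_neg (n : ℕ) (x : Fin d → ℤ) : heat n (-x) = heat n x := by
  induction n generalizing x with
  | zero => simp [heat]
  | succ n ih => exact mean_neg _ ih x

theorem sum_heat_le_one (n : ℕ) (A : Finset (Fin d → ℤ)) : ∑ z ∈ A, heat n z ≤ 1 := by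
  induction n generalizing A with
  | zero =>
    simp only [heat, Finset.sum_ite_eq']
    split_ifs <;> norm_num
  | succ n ih =>
    simp only [heat, mean]
    rw [← Finset.sum_div, Finset.sum_comm]
    apply div_le_one_of_le₀ _ (by positivity)
    calc _ ≤ ∑ e : Step d, (1 : ℝ) := by
          refine Finset.sum_le_sum fun e _ => ?_
          rw [← Finset.sum_image (f := fun z => heat n z) (g := fun z => z + vec e)
            (fun a _ b _ h => add_right_cancel h)]
          exact ih _
      _ = _ := by simp [mul_comm]

theorem sum_heat_sub_le_one (n : ℕ) (x : Fin d → ℤ) (A : Finset (Fin d → ℤ)) :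
    ∑ z ∈ A, heat n (z - x) ≤ 1 := by
  rw [← Finset.sum_image (f := fun z => heat n z) (g := fun z => z - x)
            (fun a _ b _ h => sub_left_injective h)]
  exact sum_heat_le_one n _

/-- The constant in the heat kernel bound. -/
def heatConst (d : ℕ) : ℝ := Real.sqrt (d ^ d)

theorem heatConst_pos (hd : 0 < d) : 0 < heatConst d := by
  unfold heatConst; positivity

theorem heat_le_rpow (hd : 0 < d) (n : ℕ) (x : Fin d → ℤ) :
    heat n x ≤ heatConst d * ((n : ℝ) + 1) ^ (-((d : ℝ) / 2)) := by
  refine (heat_le hd n x).trans_eq ?_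
  rw [heatConst]
  congr 1
  rw [Real.sqrt_eq_rpow, one_div, Real.inv_rpow (by positivity), Real.rpow_neg (by positivity),
    ← Real.rpow_natCast, ← Real.rpow_mul (by positivity)]
  congr 2
  ring

/-! ### Green's function and its tails -/

/-- Green's function of the walk. -/
def green (x : Fin d → ℤ) : ℝ := ∑' m, heat m x

/-- The part of Green's function that comes from times at least `T`. -/
def lateGreen (T : ℕ) (x : Fin d → ℤ) : ℝ := ∑' m, heat (m + T) x

/-- The potential of `lateGreen T`. -/
def latePot (T : ℕ) (x : Fin d → ℤ) : ℝ := ∑' m : ℕ, ((m : ℝ) + 1) * heat (m + T) x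

theorem heat_mul_le (hd : 0 < d) (m T : ℕ) (x : Fin d → ℤ) :
    ((m : ℝ) + 1) * heat (m + T) x ≤
      heatConst d * ((m : ℝ) + (T + 1 : ℕ)) ^ (-((d : ℝ) / 2 - 1)) := by
  have hpos : (0 : ℝ) < (m : ℝ) + (T + 1 : ℕ) := by positivity
  have h := heat_le_rpow hd (m + T) x
  have e1 : (((m + T : ℕ) : ℝ) + 1) = (m : ℝ) + (T + 1 : ℕ) := by push_cast; ring
  rw [e1] at h
  have e2 : ((m : ℝ) + (T + 1 : ℕ)) ^ (-((d : ℝ) / 2 - 1))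
      = ((m : ℝ) + (T + 1 : ℕ)) ^ (-((d : ℝ) / 2)) * ((m : ℝ) + (T + 1 : ℕ)) := by
    rw [← Real.rpow_add_one hpos.ne']; congr 1; ring
  rw [e2]
  have h3 : (m : ℝ) + 1 ≤ (m : ℝ) + (T + 1 : ℕ) := by push_cast; linarith [T.cast_nonneg (α := ℝ)]
  calc _ ≤ ((m : ℝ) + (T + 1 : ℕ)) * (heatConst d * ((m : ℝ) + (T + 1 : ℕ)) ^ (-((d : ℝ) / 2))) :=
        mul_le_mul h3 h (heat_nonneg _ _) hpos.le
    _ = _ := by ring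

theorem half_dim_sub_one (hd : 5 ≤ d) : (1 : ℝ) < (d : ℝ) / 2 - 1 := by
  have : (5 : ℝ) ≤ d := by exact_mod_cast hd
  linarith

theorem sum_heat_mul_le (hd : 5 ≤ d) (T n : ℕ) (x : Fin d → ℤ) :
    ∑ m ∈ Finset.range n, ((m : ℝ) + 1) * heat (m + T) x ≤
      heatConst d * (tailConst ((d : ℝ) / 2 - 1) * ((T + 1 : ℕ) : ℝ) ^ (2 - (d : ℝ) / 2)) := by
  have hc := heatConst_pos (d := d) (by omega)
  calc _ ≤ ∑ m ∈ Finset.range n, heatConst d * ((m : ℝ) + (T + 1 : ℕ)) ^ (-((d : ℝ) / 2 - 1)) :=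
        Finset.sum_le_sum fun m _ => heat_mul_le (by omega) m T x
    _ ≤ _ := by
        rw [← Finset.mul_sum]
        gcongr
        refine (sum_rpow_neg_le (half_dim_sub_one hd) (by omega) n).trans_eq ?_
        congr 2
        ring

theorem summable_latePot (hd : 5 ≤ d) (T : ℕ) (x : Fin d → ℤ) :
    Summable fun m : ℕ => ((m : ℝ) + 1) * heat (m + T) x :=
  summable_of_sum_range_le (fun m => mul_nonneg (by positivity) (heat_nonneg _ _))
    fun n => sum_heat_mul_le hd T n x

theorem summable_lateGreen (hd : 5 ≤ d) (T : ℕ) (x : Fin d → ℤ) :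
    Summable fun m : ℕ => heat (m + T) x := by
  refine Summable.of_nonneg_of_le (fun m => heat_nonneg _ _) (fun m => ?_)
    (summable_latePot hd T x)
  have h := heat_nonneg (m + T) x
  nlinarith [m.cast_nonneg (α := ℝ)]

theorem summable_green (hd : 5 ≤ d) (x : Fin d → ℤ) : Summable fun m : ℕ => heat m x :=
  summable_lateGreen hd 0 x

theorem green_nonneg (x : Fin d → ℤ) : 0 ≤ green x := tsum_nonneg fun _ => heat_nonneg _ _

theorem lateGreen_nonneg (T : ℕ) (x : Fin d → ℤ) : 0 ≤ lateGreen T x :=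
  tsum_nonneg fun _ => heat_nonneg _ _

theorem latePot_nonneg (T : ℕ) (x : Fin d → ℤ) : 0 ≤ latePot T x :=
  tsum_nonneg fun _ => mul_nonneg (by positivity) (heat_nonneg _ _)

theorem latePot_le (hd : 5 ≤ d) {T : ℕ} (hT : 1 ≤ T) (x : Fin d → ℤ) :
    latePot T x ≤
      heatConst d * tailConst ((d : ℝ) / 2 - 1) * (T : ℝ) ^ (2 - (d : ℝ) / 2) := by
  have hc := heatConst_pos (d := d) (by omega)
  have ht := tailConst_pos (half_dim_sub_one hd)
  have hs := half_dim_sub_one hd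
  refine (Real.tsum_le_of_sum_range_le
    (fun m => mul_nonneg (by positivity) (heat_nonneg _ _))
    fun n => sum_heat_mul_le hd T n x).trans ?_
  rw [← mul_assoc]
  gcongr ?_ * ?_
  refine Real.rpow_le_rpow_of_nonpos (by exact_mod_cast hT) ?_ (by linarith)
  push_cast
  linarith

theorem green_eq (hd : 5 ≤ d) (x : Fin d → ℤ) :
    green x = (if x = 0 then 1 else 0) + mean green x := by
  have h : mean green x = ∑' m, heat (m + 1) x := mean_tsum (fun y => summable_green hd y) x
  rw [h, green, (summable_green hd x).tsum_eq_zero_add]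
  rfl

theorem green_eq_early_add_late (hd : 5 ≤ d) (T : ℕ) (x : Fin d → ℤ) :
    green x = ∑ m ∈ Finset.range T, heat m x + lateGreen T x :=
  ((summable_green hd x).sum_add_tsum_nat_add T).symm

theorem latePot_eq (hd : 5 ≤ d) (T : ℕ) (x : Fin d → ℤ) :
    latePot T x = lateGreen T x + mean (latePot T) x := by
  have h : mean (latePot T) x = ∑' m : ℕ, ((m : ℝ) + 1) * heat (m + 1 + T) x := by
    refine (mean_tsum (fun y => summable_latePot hd T y) x).trans ?_
    congr 1
    ext m
    rw [mean_const_mul, show m + 1 + T = (m + T) + 1 by ring]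
    rfl
  have hs : Summable fun m : ℕ => (m : ℝ) * heat (m + T) x :=
    Summable.of_nonneg_of_le (fun m => mul_nonneg (by positivity) (heat_nonneg _ _))
      (fun m => by nlinarith [heat_nonneg (m + T) x]) (summable_latePot hd T x)
  have h2 : ∑' m : ℕ, ((m : ℝ) + 1) * heat (m + 1 + T) x = ∑' m : ℕ, (m : ℝ) * heat (m + T) x := by
    rw [hs.tsum_eq_zero_add]
    simp
  rw [h, h2, lateGreen, latePot, ← (summable_lateGreen hd T x).tsum_add hs]
  congr 1
  ext m
  ring

/-! ### Averages over finite paths -/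

/-- The average of `F` over all step sequences of length `n`. -/
def avg : ℕ → (List (Step d) → ℝ) → ℝ
  | 0, F => F []
  | n + 1, F => (∑ e : Step d, avg n fun l => F (e :: l)) / (2 * d)

theorem avg_mono {n : ℕ} {F G : List (Step d) → ℝ} (h : ∀ l, l.length = n → F l ≤ G l) :
    avg n F ≤ avg n G := by
  induction n generalizing F G with
  | zero => exact h [] rfl
  | succ n ih =>
    simp only [avg]
    gcongr
    exact ih fun l hl => h _ (by simp [hl])

theorem avg_const (hd : 0 < d) (n : ℕ) (c : ℝ) : avg (d := d) n (fun _ => c) = c := by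
  have : (d : ℝ) ≠ 0 := by positivity
  induction n with
  | zero => rfl
  | succ n ih =>
    simp only [avg, ih]
    simp
    field_simp

theorem avg_add (n : ℕ) (F G : List (Step d) → ℝ) :
    avg n (fun l => F l + G l) = avg n F + avg n G := by
  induction n generalizing F G with
  | zero => rfl
  | succ n ih => simp only [avg, ih, Finset.sum_add_distrib, add_div]

theorem avg_const_mul (n : ℕ) (c : ℝ) (F : List (Step d) → ℝ) :
    avg n (fun l => c * F l) = c * avg n F := by
  induction n generalizing F with
  | zero => rfl
  | succ n ih => simp only [avg, ih, ← Finset.mul_sum, mul_div_assoc]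

theorem avg_sum {ι : Type*} (n : ℕ) (s : Finset ι) (F : ι → List (Step d) → ℝ) :
    avg n (fun l => ∑ i ∈ s, F i l) = ∑ i ∈ s, avg n (F i) := by
  induction n generalizing F with
  | zero => rfl
  | succ n ih =>
    simp only [avg, ih]
    rw [Finset.sum_comm, Finset.sum_div]

theorem avg_comm (m n : ℕ) (F : List (Step d) → List (Step d) → ℝ) :
    avg m (fun l => avg n fun l' => F l l') = avg n fun l' => avg m fun l => F l l' := by
  induction m generalizing F with
  | zero => rfl
  | succ m ih =>
    simp only [avg, ih, div_eq_inv_mul, avg_const_mul, avg_sum]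

theorem avg_nonneg {n : ℕ} {F : List (Step d) → ℝ} (h : ∀ l, 0 ≤ F l) : 0 ≤ avg n F := by
  induction n generalizing F with
  | zero => exact h []
  | succ n ih => exact div_nonneg (Finset.sum_nonneg fun e _ => ih fun l => h _) (by positivity)

/-- The position after `j` steps of the path started at `x` with the given steps. -/
def pos : (Fin d → ℤ) → List (Step d) → ℕ → (Fin d → ℤ)
  | x, _, 0 => x
  | x, [], _ + 1 => x
  | x, e :: l, j + 1 => pos (x + vec e) l j

theorem pos_zero (x : Fin d → ℤ) (l : List (Step d)) : pos x l 0 = x := by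
  cases l <;> rfl

/-- The set of sites visited by a finite path. -/
def rng (x : Fin d → ℤ) (l : List (Step d)) : Finset (Fin d → ℤ) :=
  (Finset.range (l.length + 1)).image (pos x l)

theorem mem_rng {x z : Fin d → ℤ} {l : List (Step d)} :
    z ∈ rng x l ↔ ∃ j ≤ l.length, pos x l j = z := by
  simp [rng]

theorem rng_nil (x : Fin d → ℤ) : rng x [] = {x} := by
  simp [rng, pos]

theorem rng_cons (x : Fin d → ℤ) (e : Step d) (l : List (Step d)) :
    rng x (e :: l) = insert x (rng (x + vec e) l) := by
  ext z
  rw [Finset.mem_insert, mem_rng, mem_rng]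
  constructor
  · rintro ⟨j, hj, rfl⟩
    cases j with
    | zero => left; rfl
    | succ j => exact Or.inr ⟨j, by simpa using hj, rfl⟩
  · rintro (rfl | ⟨j, hj, rfl⟩)
    · exact ⟨0, by simp, rfl⟩
    · exact ⟨j + 1, by simpa using hj, rfl⟩

/-- The additive functional of a finite path with potential `V`. -/
def loc (V : (Fin d → ℤ) → ℝ) : (Fin d → ℤ) → List (Step d) → ℝ
  | x, [] => V x
  | x, e :: l => V x + loc V (x + vec e) l

theorem sum_rng_le_loc {V : (Fin d → ℤ) → ℝ} (hV : ∀ z, 0 ≤ V z) (x : Fin d → ℤ)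
    (l : List (Step d)) : ∑ z ∈ rng x l, V z ≤ loc V x l := by
  induction l generalizing x with
  | nil => simp [rng_nil, loc]
  | cons e l ih =>
    rw [rng_cons, loc]
    by_cases h : x ∈ rng (x + vec e) l
    · rw [Finset.insert_eq_of_mem h]
      linarith [ih (x + vec e), hV x]
    · rw [Finset.sum_insert h]
      linarith [ih (x + vec e)]

theorem avg_heat_pos (hd : 0 < d) {j n : ℕ} (hj : j ≤ n) (i : ℕ) (x y : Fin d → ℤ) :
    avg n (fun l => heat i (pos x l j - y)) = heat (i + j) (x - y) := by
  induction j generalizing x n with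
  | zero => simp only [pos_zero, avg_const hd, add_zero]
  | succ j ih =>
    obtain ⟨n, rfl⟩ : ∃ m, n = m + 1 := ⟨n - 1, by omega⟩
    simp only [avg, pos]
    rw [← add_assoc, heat, mean]
    congr 1
    refine Finset.sum_congr rfl fun e _ => ?_
    rw [ih (by omega), add_sub_right_comm]

/-! ### Exponential moments of additive functionals -/

theorem exp_half_mul_le {v γ : ℝ} (hv : 0 ≤ v) (hγ : γ ≤ 1) (h0 : 0 ≤ γ) :
    Real.exp (v / 2) * (1 + (γ - v)) ≤ 1 + γ := by
  have h1 : (1 + (γ - v)) / (1 + γ) ≤ Real.exp (-(v / 2)) := by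
    have h2 : (1 + (γ - v)) / (1 + γ) = 1 - v / (1 + γ) := by field_simp; ring
    rw [h2]
    calc 1 - v / (1 + γ) ≤ 1 - v / 2 := by
          have : v / 2 ≤ v / (1 + γ) := by gcongr; linarith
          linarith
      _ ≤ _ := by linarith [Real.add_one_le_exp (-(v / 2))]
  rw [div_le_iff₀ (by linarith)] at h1
  calc _ ≤ Real.exp (v / 2) * (Real.exp (-(v / 2)) * (1 + γ)) := by gcongr
    _ = _ := by rw [← mul_assoc, ← Real.exp_add]; simp

theorem avg_exp_loc_le_of_le (hd : 0 < d) {V g : (Fin d → ℤ) → ℝ} {a : ℝ} (ha : 0 < a)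
    (hV : ∀ z, 0 ≤ V z) (hg : ∀ z, 0 ≤ g z) (hga : ∀ z, g z ≤ a)
    (hVg : ∀ z, V z + mean g z ≤ g z) (n : ℕ) (x : Fin d → ℤ) :
    avg n (fun l => Real.exp (loc V x l / (2 * a))) ≤ 1 + g x / a := by
  have hm : ∀ z, 0 ≤ mean g z := fun z =>
    div_nonneg (Finset.sum_nonneg fun e _ => hg _) (by positivity)
  have key : ∀ z, Real.exp (V z / (2 * a)) * (1 + mean g z / a) ≤ 1 + g z / a := by
    intro z
    have h1 : mean g z / a ≤ g z / a - V z / a := by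
      rw [← sub_div]; gcongr; linarith [hVg z]
    have h2 := exp_half_mul_le (v := V z / a) (γ := g z / a) (div_nonneg (hV z) ha.le)
      ((div_le_one ha).mpr (hga z)) (div_nonneg (hg z) ha.le)
    refine le_trans ?_ h2
    rw [div_div, mul_comm a 2]
    gcongr
  induction n generalizing x with
  | zero =>
    refine le_trans ?_ (key x)
    have := div_nonneg (hm x) ha.le
    simp only [avg, loc]
    exact le_mul_of_one_le_right (Real.exp_pos _).le (by linarith)
  | succ n ih =>
    refine le_trans ?_ (key x)
    have hd' : (d : ℝ) ≠ 0 := by positivity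
    simp only [avg, loc, add_div _ _ (2 * a), Real.exp_add, avg_const_mul]
    rw [← Finset.mul_sum, mul_div_assoc]
    gcongr
    calc _ ≤ (∑ e : Step d, (1 + g (x + vec e) / a)) / (2 * d) := by
          gcongr with e
          exact ih _
      _ = _ := by
          rw [Finset.sum_add_distrib, ← Finset.sum_div, mean]
          simp
          field_simp

theorem avg_exp_loc_le (hd : 0 < d) {V g : (Fin d → ℤ) → ℝ} {a : ℝ} (ha : 0 < a)
    (hV : ∀ z, 0 ≤ V z) (hg : ∀ z, 0 ≤ g z) (hga : ∀ z, V z ≠ 0 → g z ≤ a)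
    (hVg : ∀ z, V z + mean g z ≤ g z) (n : ℕ) (x : Fin d → ℤ) :
    avg n (fun l => Real.exp (loc V x l / (2 * a))) ≤ 2 := by
  have h := avg_exp_loc_le_of_le hd (V := V) (g := fun z => min (g z) a) ha hV
    (fun z => le_min (hg z) ha.le) (fun z => min_le_right _ _) (fun z => ?_) n x
  · refine h.trans ?_
    have : min (g x) a / a ≤ 1 := (div_le_one ha).mpr (min_le_right _ _)
    linarith
  · have h1 : mean (fun z => min (g z) a) z ≤ mean g z := mean_mono fun y => min_le_left _ _
    have h2 : mean (fun z => min (g z) a) z ≤ a :=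
      (mean_mono fun y => min_le_right _ _).trans_eq (mean_const hd a z)
    by_cases hz : V z = 0
    · rw [hz, zero_add]
      exact le_min (h1.trans (by linarith [hVg z, hV z])) h2
    · rw [min_eq_left (hga z hz)]
      linarith [hVg z]

theorem avg_le_loc_le (hd : 0 < d) {V g : (Fin d → ℤ) → ℝ} {a : ℝ} (ha : 0 < a)
    (hV : ∀ z, 0 ≤ V z) (hg : ∀ z, 0 ≤ g z) (hga : ∀ z, V z ≠ 0 → g z ≤ a)
    (hVg : ∀ z, V z + mean g z ≤ g z) (n : ℕ) (x : Fin d → ℤ) (s : ℝ) :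
    avg n (fun l => if s ≤ loc V x l then 1 else 0) ≤ 2 * Real.exp (-(s / (2 * a))) := by
  calc _ ≤ avg n (fun l => Real.exp (-(s / (2 * a))) * Real.exp (loc V x l / (2 * a))) := by
        refine avg_mono fun l _ => ?_
        split_ifs with h
        · rw [← Real.exp_add]
          apply Real.one_le_exp
          have : s / (2 * a) ≤ loc V x l / (2 * a) := by gcongr
          linarith
        · positivity
    _ ≤ _ := by
        rw [avg_const_mul, mul_comm]
        gcongr
        exact avg_exp_loc_le hd ha hV hg hga hVg n x

/-! ### Upper tail of the intersection of two ranges -/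

theorem ind_le_ind {p q : Prop} [Decidable p] [Decidable q] (h : p → q) :
    (if p then (1 : ℝ) else 0) ≤ if q then 1 else 0 := by
  by_cases hp : p
  · simp [hp, h hp]
  · rw [if_neg hp]
    split_ifs <;> norm_num

/-- Decay rate in the large deviation bound for Green's function summed over the range. -/
def lateConst (d : ℕ) : ℝ := heatConst d * tailConst ((d : ℝ) / 2 - 1)

theorem lateConst_pos (hd : 5 ≤ d) : 0 < lateConst d :=
  mul_pos (heatConst_pos (by omega)) (tailConst_pos (half_dim_sub_one hd))

theorem sum_rng_green_le (hd : 5 ≤ d) (T : ℕ) (x y : Fin d → ℤ) (l : List (Step d)) :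
    ∑ z ∈ rng y l, green (z - x) ≤ T + loc (fun z => lateGreen T (z - x)) y l := by
  simp_rw [green_eq_early_add_late hd T]
  rw [Finset.sum_add_distrib]
  gcongr
  · rw [Finset.sum_comm]
    calc _ ≤ ∑ m ∈ Finset.range T, (1 : ℝ) :=
          Finset.sum_le_sum fun m _ => sum_heat_sub_le_one m x _
      _ = T := by simp
  · exact sum_rng_le_loc (fun z => lateGreen_nonneg _ _) _ _

theorem avg_green_rng_le (hd : 5 ≤ d) {T : ℕ} (hT : 1 ≤ T) (n : ℕ) (x : Fin d → ℤ) :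
    avg n (fun l => if 2 * (T : ℝ) < ∑ z ∈ rng 0 l, green (z - x) then 1 else 0) ≤
      2 * Real.exp (-((T : ℝ) ^ ((d : ℝ) / 2 - 1) / (2 * lateConst d))) := by
  have hT' : (0 : ℝ) < T := by exact_mod_cast hT
  have hL := lateConst_pos hd
  set a := lateConst d * (T : ℝ) ^ (2 - (d : ℝ) / 2) with ha
  have ha0 : 0 < a := by positivity
  have key := avg_le_loc_le (by omega : 0 < d) (V := fun z => lateGreen T (z - x))
    (g := fun z => latePot T (z - x)) ha0 (fun z => lateGreen_nonneg _ _)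
    (fun z => latePot_nonneg _ _) (fun z _ => latePot_le hd hT _)
    (fun z => by rw [mean_shift, ← latePot_eq hd]) n 0 T
  have e : (T : ℝ) / (2 * a) = (T : ℝ) ^ ((d : ℝ) / 2 - 1) / (2 * lateConst d) := by
    have : (T : ℝ) ^ ((d : ℝ) / 2 - 1) * (T : ℝ) ^ (2 - (d : ℝ) / 2) = T := by
      rw [← Real.rpow_add hT']
      ring_nf
      exact Real.rpow_one _
    rw [div_eq_div_iff (by positivity) (by positivity), ha]
    linear_combination (-(2 * lateConst d)) * this
  rw [e] at key
  refine le_trans (avg_mono fun l _ => ?_) key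
  have := sum_rng_green_le hd T x 0 l
  exact ind_le_ind fun h => by linarith

/-- Constant in the bound for the probability of a late intersection. -/
def meetConst (d : ℕ) : ℝ := heatConst d * tailConst ((d : ℝ) / 2)

theorem half_dim_gt_one (hd : 5 ≤ d) : (1 : ℝ) < (d : ℝ) / 2 := by
  linarith [half_dim_sub_one hd]

theorem meetConst_pos (hd : 5 ≤ d) : 0 < meetConst d :=
  mul_pos (heatConst_pos (by omega)) (tailConst_pos (half_dim_gt_one hd))

theorem sum_heat_add_le (hd : 5 ≤ d) (j n : ℕ) (x : Fin d → ℤ) :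
    ∑ i ∈ Finset.range n, heat (j + i) x ≤
      meetConst d * ((j : ℝ) + 1) ^ (-((d : ℝ) / 2 - 1)) := by
  have hc := heatConst_pos (d := d) (by omega)
  calc _ ≤ ∑ i ∈ Finset.range n, heatConst d * ((i : ℝ) + (j + 1 : ℕ)) ^ (-((d : ℝ) / 2)) := by
        refine Finset.sum_le_sum fun i _ => (heat_le_rpow (by omega) _ _).trans_eq ?_
        congr 2
        push_cast
        ring
    _ ≤ heatConst d * (tailConst ((d : ℝ) / 2) * ((j + 1 : ℕ) : ℝ) ^ (1 - (d : ℝ) / 2)) := by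
        rw [← Finset.mul_sum]
        gcongr
        exact sum_rpow_neg_le (half_dim_gt_one hd) (by omega) n
    _ = _ := by
        rw [meetConst, mul_assoc]
        push_cast
        congr 3
        ring

theorem ind_mem_rng_le (x z : Fin d → ℤ) (l : List (Step d)) :
    (if z ∈ rng x l then 1 else 0 : ℝ) ≤
      ∑ i ∈ Finset.range (l.length + 1), heat 0 (z - pos x l i) := by
  split_ifs with h
  · obtain ⟨i, hi, rfl⟩ := mem_rng.mp h
    refine le_trans ?_ (Finset.single_le_sum (f := fun j => heat 0 (pos x l i - pos x l j))
      (fun j _ => heat_nonneg _ _) (Finset.mem_range.mpr (Nat.lt_succ_of_le hi)))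
    simp [heat]
  · exact Finset.sum_nonneg fun j _ => heat_nonneg _ _

theorem avg_avg_mem_rng_le_sum (hd : 0 < d) {j n : ℕ} (hj : j ≤ n) (m : ℕ) (x y : Fin d → ℤ) :
    avg m (fun l' => avg n fun l => if pos x l j ∈ rng y l' then 1 else 0) ≤
      ∑ i ∈ Finset.range (m + 1), heat (j + i) (y - x) := by
  calc _ ≤ avg m (fun l' => avg n fun l =>
        ∑ i ∈ Finset.range (m + 1), heat 0 (pos x l j - pos y l' i)) := by
        refine avg_mono fun l' hl' => avg_mono fun l _ => ?_
        rw [← hl']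
        exact ind_mem_rng_le _ _ _
    _ = ∑ i ∈ Finset.range (m + 1), avg m (fun l' => heat j (pos y l' i - x)) := by
        simp_rw [avg_sum, avg_heat_pos hd hj, zero_add]
        refine Finset.sum_congr rfl fun i _ => ?_
        congr 1
        ext l'
        rw [← heat_neg, neg_sub]
    _ = _ := by
        refine Finset.sum_congr rfl fun i hi => ?_
        rw [avg_heat_pos hd (by simpa [Nat.lt_succ_iff] using hi)]

theorem le_rpow_mul_rpow {p u v : ℝ} (hp : 0 ≤ p) (hu : p ≤ u) (hv : p ≤ v) :
    p ≤ u ^ (1 / 4 : ℝ) * v ^ (3 / 4 : ℝ) := by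
  have : p = p ^ (1 / 4 : ℝ) * p ^ (3 / 4 : ℝ) := by
    rw [← Real.rpow_add_of_nonneg hp (by norm_num) (by norm_num)]
    norm_num
  calc p = p ^ (1 / 4 : ℝ) * p ^ (3 / 4 : ℝ) := this
    _ ≤ _ := mul_le_mul (Real.rpow_le_rpow hp hu (by norm_num))
      (Real.rpow_le_rpow hp hv (by norm_num)) (Real.rpow_nonneg hp _)
      (Real.rpow_nonneg (hp.trans hu) _)

theorem avg_inter_green_le (hd : 5 ≤ d) (l' : List (Step d)) (n : ℕ) {a : ℝ} (ha : 0 < a)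
    (t : ℝ) :
    avg n (fun l => if t < (((rng 0 l ∩ rng 0 l').filter
        fun x => ∑ z ∈ rng 0 l', green (z - x) ≤ a).card : ℝ) then 1 else 0) ≤
      2 * Real.exp (-(t / (2 * a))) := by
  set A := (rng 0 l').filter fun x => ∑ z ∈ rng 0 l', green (z - x) ≤ a with hA
  have hgn : ∀ x, green (-x : Fin d → ℤ) = green x := fun x => by simp only [green, heat_neg]
  refine le_trans (avg_mono fun l _ => ?_) (avg_le_loc_le (by omega : 0 < d)
    (V := fun x => if x ∈ A then 1 else 0) (g := fun x => ∑ z ∈ A, green (x - z)) ha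
    (fun z => by split_ifs <;> norm_num) (fun z => Finset.sum_nonneg fun _ _ => green_nonneg _)
    (fun x hx => ?_) (fun x => ?_) n 0 t)
  · have h1 := sum_rng_le_loc (V := fun x => if x ∈ A then (1 : ℝ) else 0)
      (fun z => by split_ifs <;> norm_num) 0 l
    have h2 : ((rng 0 l ∩ rng 0 l').filter
        fun x => ∑ z ∈ rng 0 l', green (z - x) ≤ a) = (rng 0 l).filter (· ∈ A) := by
      ext x
      simp [hA, and_assoc]
    rw [Finset.sum_boole, ← h2] at h1
    exact ind_le_ind fun h => by linarith
  · have hxA : x ∈ A := by by_contra h; simp [h] at hx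
    refine le_trans ?_ (Finset.mem_filter.mp hxA).2
    refine (Finset.sum_le_sum_of_subset_of_nonneg (Finset.filter_subset _ _)
      fun _ _ _ => green_nonneg _).trans_eq (Finset.sum_congr rfl fun z _ => ?_)
    rw [← hgn, neg_sub]
  · rw [mean_sum]
    simp_rw [mean_shift]
    have : ∑ z ∈ A, green (x - z) = ∑ z ∈ A, ((if x = z then 1 else 0) + mean green (x - z)) := by
      refine Finset.sum_congr rfl fun z _ => ?_
      rw [green_eq hd]
      simp [sub_eq_zero]
    rw [this, Finset.sum_add_distrib, Finset.sum_ite_eq]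

theorem avg_inter_le_sum (hd : 5 ≤ d) (m n : ℕ) {a t : ℝ} (ha : 0 < a) :
    avg m (fun l' => avg n fun l =>
        if t < ((rng (0 : Fin d → ℤ) l ∩ rng 0 l').card : ℝ) then (1 : ℝ) else 0) ≤
      2 * Real.exp (-(t / (2 * a))) + ∑ j ∈ Finset.range (n + 1), avg m (fun l' => avg n fun l =>
        if pos (0 : Fin d → ℤ) l j ∈ rng 0 l' ∧
          a < ∑ z ∈ rng 0 l', green (z - pos (0 : Fin d → ℤ) l j) then (1 : ℝ) else 0) := by
  rw [← avg_sum]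
  simp_rw [← avg_sum]
  rw [← avg_const (by omega : 0 < d) m (2 * Real.exp (-(t / (2 * a)))), ← avg_add]
  refine avg_mono fun l' _ => ?_
  refine le_trans ?_ (add_le_add_left (avg_inter_green_le hd l' n ha t) _)
  rw [← avg_add]
  refine avg_mono fun l hl => ?_
  have hnn : 0 ≤ ∑ j ∈ Finset.range (n + 1), (if pos (0 : Fin d → ℤ) l j ∈ rng 0 l' ∧
      a < ∑ z ∈ rng 0 l', green (z - pos (0 : Fin d → ℤ) l j) then (1 : ℝ) else 0) :=
    Finset.sum_nonneg fun j _ => by split_ifs <;> norm_num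
  by_cases h : ∃ x ∈ rng 0 l ∩ rng 0 l', a < ∑ z ∈ rng 0 l', green (z - x)
  · obtain ⟨x, hx, hxa⟩ := h
    rw [Finset.mem_inter] at hx
    obtain ⟨j, hj, rfl⟩ := mem_rng.mp hx.1
    have h1 := Finset.single_le_sum (f := fun j => (if pos (0 : Fin d → ℤ) l j ∈ rng 0 l' ∧
        a < ∑ z ∈ rng 0 l', green (z - pos (0 : Fin d → ℤ) l j) then (1 : ℝ) else 0))
      (fun j _ => by split_ifs <;> norm_num) (Finset.mem_range.mpr (show j < n + 1 by omega))
    simp only [hx.2, hxa, and_self, if_true] at h1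
    split_ifs <;> linarith
  · push Not at h
    rw [Finset.filter_true_of_mem h]
    linarith

theorem avg_inter_le (hd : 5 ≤ d) :
    ∃ K > 0, ∃ c > 0, ∀ (m n : ℕ) (t : ℝ), 1 < t →
      avg m (fun l' => avg n fun l =>
        if t < ((rng (0 : Fin d → ℤ) l ∩ rng 0 l').card : ℝ) then (1 : ℝ) else 0) ≤
      K * Real.exp (-(c * t ^ (1 - 2 / (d : ℝ)))) := by
  have hL := lateConst_pos hd
  have hM := meetConst_pos hd
  have hd5 : (5 : ℝ) ≤ d := by exact_mod_cast hd
  set s : ℝ := ((d : ℝ) / 2 - 1) * (3 / 4) with hs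
  have hs1 : 1 < s := by rw [hs]; linarith
  have hts := tailConst_pos hs1
  set K₂ : ℝ := (2 : ℝ) ^ (1 / 4 : ℝ) * meetConst d ^ (3 / 4 : ℝ) * tailConst s with hK₂
  have hK₂0 : 0 < K₂ := by positivity
  refine ⟨2 + K₂, by positivity, min (1 / 8) (1 / (8 * lateConst d)), by positivity, ?_⟩
  intro m n t ht
  have ht0 : 0 < t := by linarith
  set T : ℕ := ⌈t ^ (2 / (d : ℝ))⌉₊ with hTdef
  have ht2 : 1 ≤ t ^ (2 / (d : ℝ)) := Real.one_le_rpow ht.le (by positivity)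
  have hT1 : t ^ (2 / (d : ℝ)) ≤ T := Nat.le_ceil _
  have hT2 : (T : ℝ) ≤ 2 * t ^ (2 / (d : ℝ)) := by
    have := Nat.ceil_lt_add_one (show 0 ≤ t ^ (2 / (d : ℝ)) by linarith)
    linarith
  have hTpos : 1 ≤ T := by exact_mod_cast ht2.trans hT1
  have hT0 : (0 : ℝ) < T := by exact_mod_cast hTpos
  set u := t ^ (1 - 2 / (d : ℝ)) with hu
  have hu0 : 0 < u := by positivity
  have e1 : u / 8 ≤ t / (2 * (2 * T)) := by
    rw [div_le_div_iff₀ (by norm_num) (by positivity)]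
    have : u * t ^ (2 / (d : ℝ)) = t := by
      rw [hu, ← Real.rpow_add ht0]; simp
    nlinarith
  have e2 : u ≤ (T : ℝ) ^ ((d : ℝ) / 2 - 1) := by
    calc u = (t ^ (2 / (d : ℝ))) ^ ((d : ℝ) / 2 - 1) := by
          rw [← Real.rpow_mul ht0.le, hu]
          congr 1
          field_simp
      _ ≤ _ := Real.rpow_le_rpow (by positivity) hT1 (by linarith)
  have hbase := avg_inter_le_sum hd m n (a := 2 * T) (t := t) (by positivity)
  set c := min (1 / 8) (1 / (8 * lateConst d)) with hc
  have b1 : Real.exp (-(t / (2 * (2 * T)))) ≤ Real.exp (-(c * u)) := by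
    apply Real.exp_le_exp.mpr
    have : c * u ≤ 1 / 8 * u := by gcongr; exact min_le_left _ _
    linarith
  set E := 2 * Real.exp (-((T : ℝ) ^ ((d : ℝ) / 2 - 1) / (2 * lateConst d))) with hE
  have b2 : E ^ (1 / 4 : ℝ) ≤ 2 ^ (1 / 4 : ℝ) * Real.exp (-(c * u)) := by
    rw [hE, Real.mul_rpow (by norm_num) (by positivity), ← Real.exp_mul]
    gcongr
    have h1 : c * u ≤ 1 / (8 * lateConst d) * u := by gcongr; exact min_le_right _ _
    have h2 : 1 / (8 * lateConst d) * u ≤ 1 / (8 * lateConst d) * (T : ℝ) ^ ((d : ℝ) / 2 - 1) := by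
      gcongr
    have h3 : -((T : ℝ) ^ ((d : ℝ) / 2 - 1) / (2 * lateConst d)) * (1 / 4)
        = -(1 / (8 * lateConst d) * (T : ℝ) ^ ((d : ℝ) / 2 - 1)) := by field_simp; ring
    rw [h3]
    linarith
  have b3 : ∀ j ∈ Finset.range (n + 1), avg m (fun l' => avg n fun l =>
        if pos (0 : Fin d → ℤ) l j ∈ rng 0 l' ∧ 2 * (T : ℝ) < ∑ z ∈ rng 0 l', green (z - pos 0 l j)
          then (1 : ℝ) else 0)
      ≤ E ^ (1 / 4 : ℝ) * (meetConst d ^ (3 / 4 : ℝ) * ((j : ℝ) + (1 : ℕ)) ^ (-s)) := by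
    intro j hj
    have hjn : j ≤ n := by simpa [Nat.lt_succ_iff] using hj
    have e3 : meetConst d ^ (3 / 4 : ℝ) * ((j : ℝ) + (1 : ℕ)) ^ (-s)
        = (meetConst d * ((j : ℝ) + 1) ^ (-((d : ℝ) / 2 - 1))) ^ (3 / 4 : ℝ) := by
      rw [Real.mul_rpow hM.le (by positivity), ← Real.rpow_mul (by positivity), hs]
      push_cast
      congr 2
      ring
    rw [e3]
    apply le_rpow_mul_rpow
    · exact avg_nonneg fun l' => avg_nonneg fun l => by split_ifs <;> norm_num
    · rw [avg_comm, ← avg_const (by omega : 0 < d) n E]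
      refine avg_mono fun l _ => ?_
      refine le_trans (avg_mono fun l' _ => ?_) (avg_green_rng_le hd hTpos m (pos 0 l j))
      exact ind_le_ind fun h => h.2
    · refine le_trans (avg_mono fun l' _ => avg_mono fun l _ => ?_)
        ((avg_avg_mem_rng_le_sum (by omega) hjn m 0 0).trans (sum_heat_add_le hd j (m + 1) _))
      exact ind_le_ind fun h => h.1
  have b4 := sum_rpow_neg_le hs1 le_rfl (n + 1)
  rw [Nat.cast_one, Real.one_rpow, mul_one] at b4
  calc _ ≤ _ := hbase
    _ ≤ 2 * Real.exp (-(c * u)) + ∑ j ∈ Finset.range (n + 1),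
        E ^ (1 / 4 : ℝ) * (meetConst d ^ (3 / 4 : ℝ) * ((j : ℝ) + (1 : ℕ)) ^ (-s)) := by
        gcongr with j hj
        exact b3 j hj
    _ ≤ 2 * Real.exp (-(c * u)) + (2 ^ (1 / 4 : ℝ) * Real.exp (-(c * u))) *
        (meetConst d ^ (3 / 4 : ℝ) * tailConst s) := by
        rw [← Finset.mul_sum, ← Finset.mul_sum]
        simp only [Nat.cast_one]
        gcongr
    _ = _ := by rw [hK₂]; ring

/-! ### Two walks meet only at the origin with positive probability -/

theorem heat_eq_zero {i : ℕ} {x : Fin d → ℤ} (a : Fin d) (h : (i : ℤ) < |x a|) :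
    heat i x = 0 := by
  induction i generalizing x with
  | zero =>
    have : x ≠ 0 := by rintro rfl; simp at h
    simp [heat, this]
  | succ i ih =>
    rw [heat, mean, Finset.sum_eq_zero, zero_div]
    intro e _
    apply ih
    have h1 : |vec e a| ≤ 1 := by
      rcases eq_or_ne a e.1 with rfl | hne
      · rcases e.2 with _ | _ <;> simp [vec] <;> split_ifs <;> simp
      · simp [vec, hne]
    have h2 : |x a| ≤ |x a + vec e a| + |vec e a| := by
      have := abs_sub (x a + vec e a) (vec e a)
      simpa using this
    push_cast at h
    simp only [Pi.add_apply]
    linarith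

theorem sum_heat_add_le_of_eq_zero (hd : 5 ≤ d) {T : ℕ} {x : Fin d → ℤ}
    (hx : ∀ i < T, heat i x = 0) (j n : ℕ) :
    ∑ i ∈ Finset.range n, heat (j + i) x ≤
      meetConst d * (((max j T : ℕ) : ℝ) + 1) ^ (-((d : ℝ) / 2 - 1)) := by
  refine le_trans ?_ (sum_heat_add_le hd (max j T) n x)
  calc _ ≤ ∑ i ∈ Finset.range ((T - j) + n), heat (j + i) x :=
        Finset.sum_le_sum_of_subset_of_nonneg (by simp) fun _ _ _ => heat_nonneg _ _
    _ = _ := by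
        rw [Finset.sum_range_add, Finset.sum_eq_zero fun i hi => hx _ ?_, zero_add]
        · refine Finset.sum_congr rfl fun i _ => ?_
          congr 1
          omega
        · have := Finset.mem_range.mp hi
          omega

theorem rng_replicate_append {M : ℕ} {e : Step d} {l : List (Step d)} {x z : Fin d → ℤ}
    (h : z ∈ rng x (List.replicate M e ++ l)) :
    (∃ j < M, z = x + j • vec e) ∨ z ∈ rng (x + M • vec e) l := by
  induction M generalizing x with
  | zero => right; simpa using h
  | succ M ih =>
    rw [List.replicate_succ, List.cons_append, rng_cons, Finset.mem_insert] at h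
    rcases h with rfl | h
    · exact Or.inl ⟨0, by omega, by simp⟩
    · have e1 : ∀ j : ℕ, x + vec e + j • vec e = x + (j + 1) • vec e := fun j => by
        rw [succ_nsmul]; abel
      rcases ih h with ⟨j, hj, rfl⟩ | h
      · exact Or.inl ⟨j + 1, by omega, e1 j⟩
      · exact Or.inr (by rwa [← e1])

theorem avg_replicate_append_le {M : ℕ} (hd : 0 < d) (e : Step d) (n : ℕ)
    {F : List (Step d) → ℝ} (hF : ∀ l, 0 ≤ F l) :
    ((2 * d : ℝ) ^ M)⁻¹ * avg n (fun l => F (List.replicate M e ++ l)) ≤ avg (M + n) F := by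
  induction M generalizing F with
  | zero => simp
  | succ M ih =>
    rw [add_right_comm, avg, le_div_iff₀ (by positivity)]
    have h1 := ih (F := fun l => F (e :: l)) fun l => hF _
    refine le_trans (le_trans (le_of_eq ?_) h1) (Finset.single_le_sum
      (f := fun e => avg (M + n) fun l => F (e :: l)) (fun e _ => avg_nonneg fun l => hF _)
      (Finset.mem_univ e))
    simp only [List.replicate_succ, List.cons_append]
    field_simp
    ring

theorem avg_mem_rng_le (hd : 0 < d) (n : ℕ) (x z : Fin d → ℤ) :
    avg n (fun l => if z ∈ rng x l then 1 else 0) ≤ ∑ i ∈ Finset.range (n + 1), heat i (z - x) := by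
  calc _ ≤ avg n (fun l => ∑ i ∈ Finset.range (n + 1), heat 0 (z - pos x l i)) := by
        refine avg_mono fun l hl => ?_
        rw [← hl]
        exact ind_mem_rng_le _ _ _
    _ = _ := by
        rw [avg_sum]
        refine Finset.sum_congr rfl fun i hi => ?_
        rw [← heat_neg, neg_sub, ← zero_add i,
          ← avg_heat_pos hd (n := n) (by simpa [Nat.lt_succ_iff] using hi)]
        congr 1
        ext l
        rw [← heat_neg, neg_sub, zero_add]

theorem avg_nsmul_mem_rng_le (hd : 5 ≤ d) {M : ℕ} (hM : 1 ≤ M) (a : Fin d) (b : Bool) (n : ℕ) :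
    ∑ j ∈ Finset.range M, avg n (fun l =>
      if j • vec (a, b) ∈ rng (M • vec (a, !b)) l then (1 : ℝ) else 0) ≤
      meetConst d * tailConst ((d : ℝ) / 2 - 1) * (M : ℝ) ^ (1 - ((d : ℝ) / 2 - 1)) := by
  have hm := meetConst_pos hd
  have hs := half_dim_sub_one hd
  have hM' : (0 : ℝ) < M := by exact_mod_cast hM
  rw [mul_assoc]
  refine le_trans ?_ (mul_le_mul_of_nonneg_left (sum_rpow_neg_le hs hM M) hm.le)
  rw [Finset.mul_sum]
  refine Finset.sum_le_sum fun j _ => (avg_mem_rng_le (by omega) n _ _).trans ?_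
  have h := sum_heat_add_le_of_eq_zero hd (T := j + M)
    (x := j • vec (a, b) - M • vec (a, !b)) (fun i hi => heat_eq_zero a ?_) 0 (n + 1)
  · simp only [zero_add, Nat.zero_max] at h
    refine h.trans (mul_le_mul_of_nonneg_left ?_ hm.le)
    apply Real.rpow_le_rpow_of_nonpos (by positivity) (by push_cast; linarith) (by linarith)
  · have : (i : ℤ) < j + M := by exact_mod_cast hi
    have h2 : (0 : ℤ) ≤ (j : ℤ) + M := by positivity
    cases b
    · have : (j • vec (a, false) - M • vec (a, !false)) a = -((j : ℤ) + M) := by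
        simp [vec]; ring
      rw [this, abs_neg, abs_of_nonneg h2]
      assumption
    · have : (j • vec (a, true) - M • vec (a, !true)) a = (j : ℤ) + M := by
        simp [vec]
      rw [this, abs_of_nonneg h2]
      assumption

theorem avg_avg_meet_le (hd : 5 ≤ d) {M : ℕ} (hM : 1 ≤ M) (a : Fin d) (n : ℕ) :
    ∑ j ∈ Finset.range (n + 1), avg n (fun l' => avg n fun l =>
      if pos (M • vec (a, false)) l j ∈ rng (M • vec (a, true)) l' then (1 : ℝ) else 0) ≤
      meetConst d * 2 ^ ((d : ℝ) / 2 - 1) * tailConst ((d : ℝ) / 2 - 1) *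
        (M : ℝ) ^ (1 - ((d : ℝ) / 2 - 1)) := by
  have hm := meetConst_pos hd
  have hs := half_dim_sub_one hd
  have hM' : (0 : ℝ) < M := by exact_mod_cast hM
  rw [mul_assoc _ (tailConst _)]
  refine le_trans ?_ (mul_le_mul_of_nonneg_left (sum_rpow_neg_le hs hM (n + 1))
    (by positivity : 0 ≤ meetConst d * 2 ^ ((d : ℝ) / 2 - 1)))
  rw [Finset.mul_sum]
  refine Finset.sum_le_sum fun j hj =>
    (avg_avg_mem_rng_le_sum (by omega) (by simpa [Nat.lt_succ_iff] using hj) n _ _).trans ?_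
  have h := sum_heat_add_le_of_eq_zero hd (T := M + M)
    (x := M • vec (a, true) - M • vec (a, false)) (fun i hi => heat_eq_zero a ?_) j (n + 1)
  · refine h.trans ?_
    rw [mul_assoc]
    refine mul_le_mul_of_nonneg_left ?_ hm.le
    have e1 : (2 : ℝ) ^ ((d : ℝ) / 2 - 1) * ((j : ℝ) + M) ^ (-((d : ℝ) / 2 - 1))
        = (((j : ℝ) + M) / 2) ^ (-((d : ℝ) / 2 - 1)) := by
      rw [Real.div_rpow (by positivity) (by norm_num), Real.rpow_neg (by norm_num : (0 : ℝ) ≤ 2)]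
      field_simp
    rw [e1]
    apply Real.rpow_le_rpow_of_nonpos (by positivity) _ (by linarith)
    have h1 : (j : ℝ) ≤ (max j (M + M) : ℕ) := by exact_mod_cast le_max_left _ _
    have h2 : (M : ℝ) + M ≤ (max j (M + M) : ℕ) := by exact_mod_cast le_max_right _ _
    linarith
  · have : (M • vec (a, true) - M • vec (a, false)) a = (M : ℤ) + M := by
      simp [vec]
    rw [this, abs_of_nonneg (by positivity)]
    exact_mod_cast hi

theorem avg_one_lt_card_inter_le (hd : 5 ≤ d) : ∃ M : ℕ, ∃ δ > 0, ∀ n : ℕ,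
    avg (M + n) (fun l' => avg (M + n) fun l =>
      if 1 < (rng (0 : Fin d → ℤ) l ∩ rng 0 l').card then (1 : ℝ) else 0) ≤ 1 - δ := by
  have hd0 : 0 < d := by omega
  have hm := meetConst_pos hd
  have hs := half_dim_sub_one hd
  have ht := tailConst_pos hs
  set s : ℝ := (d : ℝ) / 2 - 1 with hsdef
  set c : ℝ := meetConst d * 2 ^ s * tailConst s + 2 * (meetConst d * tailConst s) with hc
  obtain ⟨M, hM, hM1⟩ : ∃ M : ℕ, c * (M : ℝ) ^ (1 - s) ≤ 1 / 2 ∧ 1 ≤ M := by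
    have h1 : Filter.Tendsto (fun M : ℕ => c * (M : ℝ) ^ (-(s - 1))) Filter.atTop (nhds (c * 0)) :=
      ((tendsto_rpow_neg_atTop (by linarith)).comp tendsto_natCast_atTop_atTop).const_mul c
    rw [mul_zero] at h1
    obtain ⟨M, h2, h3⟩ := ((h1.eventually (gt_mem_nhds (by norm_num : (0 : ℝ) < 1 / 2))).and
      (Filter.eventually_ge_atTop 1)).exists
    exact ⟨M, by rw [← neg_sub s 1]; exact h2.le, h3⟩
  let a : Fin d := ⟨0, hd0⟩
  set q : ℝ := ((2 * d : ℝ) ^ M)⁻¹ with hq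
  have hq0 : 0 < q := by positivity
  refine ⟨M, q * (q * (1 / 2)), by positivity, fun n => ?_⟩
  set F : List (Step d) → List (Step d) → ℝ := fun l' l =>
    if 1 < (rng (0 : Fin d → ℤ) l ∩ rng 0 l').card then (0 : ℝ) else 1 with hF
  have hF0 : ∀ l' l, 0 ≤ F l' l := fun l' l => by
    simp only [hF]
    split_ifs <;> norm_num
  have hcompl : avg (M + n) (fun l' => avg (M + n) fun l =>
      if 1 < (rng (0 : Fin d → ℤ) l ∩ rng 0 l').card then (1 : ℝ) else 0)
      + avg (M + n) (fun l' => avg (M + n) fun l => F l' l) = 1 := by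
    rw [← avg_add]
    simp_rw [← avg_add]
    have : ∀ l' l, (if 1 < (rng (0 : Fin d → ℤ) l ∩ rng 0 l').card then (1 : ℝ) else 0) + F l' l
        = 1 := fun l' l => by
      simp only [hF]
      split_ifs <;> norm_num
    simp only [this, avg_const hd0]
  suffices h : q * (q * (1 / 2)) ≤ avg (M + n) (fun l' => avg (M + n) fun l => F l' l) by linarith
  have k1 := avg_replicate_append_le (M := M) hd0 (a, true) n
    (F := fun l' => avg (M + n) fun l => F l' l) fun l' => avg_nonneg fun l => hF0 _ _
  refine le_trans (mul_le_mul_of_nonneg_left ?_ hq0.le) k1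
  have k2 : avg n (fun l' => q * avg n fun l =>
        F (List.replicate M (a, true) ++ l') (List.replicate M (a, false) ++ l)) ≤
      avg n (fun l' => avg (M + n) fun l => F (List.replicate M (a, true) ++ l') l) :=
    avg_mono fun l' _ => avg_replicate_append_le hd0 (a, false) n fun l => hF0 _ _
  rw [avg_const_mul] at k2
  refine le_trans (mul_le_mul_of_nonneg_left ?_ hq0.le) k2
  have k3 : avg (d := d) n (fun l' => avg (d := d) n fun l => (1 : ℝ)) ≤
      avg n (fun l' => avg n fun l =>
        F (List.replicate M (a, true) ++ l') (List.replicate M (a, false) ++ l)) +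
      (∑ j ∈ Finset.range (n + 1), avg n (fun l' => avg n fun l =>
        if pos (M • vec (a, false)) l j ∈ rng (M • vec (a, true)) l' then (1 : ℝ) else 0)
      + ∑ j ∈ Finset.range M, avg n (fun l' => avg n fun _ : List (Step d) =>
          if j • vec (a, false) ∈ rng (M • vec (a, !false)) l' then (1 : ℝ) else 0)
      + ∑ j ∈ Finset.range M, avg n (fun _ : List (Step d) => avg n fun l =>
          if j • vec (a, true) ∈ rng (M • vec (a, !true)) l then (1 : ℝ) else 0)) := by
    rw [← avg_sum, ← avg_sum, ← avg_sum]
    simp_rw [← avg_sum]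
    simp_rw [← avg_add]
    refine avg_mono fun l' _ => avg_mono fun l hl => ?_
    have p0 : ∀ (p : Prop) [Decidable p], (0 : ℝ) ≤ if p then 1 else 0 := fun p _ => by
      split_ifs <;> norm_num
    have n1 := Finset.sum_nonneg (s := Finset.range (n + 1)) fun j _ =>
      p0 (pos (M • vec (a, false)) l j ∈ rng (M • vec (a, true)) l')
    have n2 := Finset.sum_nonneg (s := Finset.range M) fun j _ =>
      p0 (j • vec (a, false) ∈ rng (M • vec (a, !false)) l')
    have n3 := Finset.sum_nonneg (s := Finset.range M) fun j _ =>
      p0 (j • vec (a, true) ∈ rng (M • vec (a, !true)) l)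
    simp only [hF]
    split_ifs with h
    · obtain ⟨z, hz, hz0⟩ := Finset.exists_mem_ne h 0
      rw [Finset.mem_inter] at hz
      have g1 := rng_replicate_append hz.1
      have g2 := rng_replicate_append hz.2
      rw [zero_add] at g1 g2
      simp only [zero_add] at g1 g2 ⊢
      rcases g1 with ⟨j, hj, rfl⟩ | g1
      · rcases g2 with ⟨i, hi, h4⟩ | g2
        · exfalso
          apply hz0
          have := congrFun h4 a
          simp [vec] at this
          have : j = 0 := by omega
          rw [this, zero_smul]
        · have := Finset.single_le_sum (f := fun j : ℕ =>
            if j • vec (a, false) ∈ rng (M • vec (a, !false)) l' then (1 : ℝ) else 0)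
            (fun j _ => p0 _) (Finset.mem_range.mpr hj)
          simp only [Bool.not_false, g2, if_true] at this n2 ⊢
          linarith
      · rcases g2 with ⟨i, hi, rfl⟩ | g2
        · have := Finset.single_le_sum (f := fun j : ℕ =>
            if j • vec (a, true) ∈ rng (M • vec (a, !true)) l then (1 : ℝ) else 0)
            (fun j _ => p0 _) (Finset.mem_range.mpr hi)
          simp only [Bool.not_true, g1, if_true] at this n3 ⊢
          linarith
        · obtain ⟨j, hj, rfl⟩ := mem_rng.mp g1
          have := Finset.single_le_sum (f := fun j : ℕ =>
            if pos (M • vec (a, false)) l j ∈ rng (M • vec (a, true)) l' then (1 : ℝ) else 0)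
            (fun j _ => p0 _) (Finset.mem_range.mpr (show j < n + 1 by omega))
          simp only [g2, if_true] at this
          linarith
    · linarith
  simp only [avg_const hd0] at k3
  have k4 := avg_avg_meet_le hd hM1 a n
  have k5 := avg_nsmul_mem_rng_le hd hM1 a false n
  have k6 := avg_nsmul_mem_rng_le hd hM1 a true n
  have k7 : c * (M : ℝ) ^ (1 - s) = meetConst d * 2 ^ s * tailConst s * (M : ℝ) ^ (1 - s)
      + 2 * (meetConst d * tailConst s * (M : ℝ) ^ (1 - s)) := by rw [hc]; ring
  linarith

/-- Upper tail bound for the number of common sites of two finite walks. -/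
theorem avg_inter_le_exp (hd : 5 ≤ d) :
    ∃ M : ℕ, ∃ c > 0, ∀ (n : ℕ) (t : ℝ), 1 < t →
      avg (M + n) (fun l' => avg (M + n) fun l =>
        if t < ((rng (0 : Fin d → ℤ) l ∩ rng 0 l').card : ℝ) then (1 : ℝ) else 0) ≤
      Real.exp (-(c * t ^ (1 - 2 / (d : ℝ)))) := by
  obtain ⟨K, hK, c, hc, h1⟩ := avg_inter_le (d := d) hd
  obtain ⟨M, δ, hδ, h2⟩ := avg_one_lt_card_inter_le (d := d) hd
  set s₀ : ℝ := max 1 (2 * Real.log (max K 1) / c) with hs₀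
  have hs₀1 : 1 ≤ s₀ := le_max_left _ _
  have hs₀2 : Real.log (max K 1) ≤ c * s₀ / 2 := by
    have : 2 * Real.log (max K 1) / c ≤ s₀ := le_max_right _ _
    rw [div_le_iff₀ hc] at this
    linarith
  refine ⟨M, min (c / 2) (δ / s₀), by positivity, fun n t ht => ?_⟩
  set u := t ^ (1 - 2 / (d : ℝ)) with hu
  have hu0 : 0 < u := by positivity
  rcases le_total s₀ u with h | h
  · refine (h1 _ _ t ht).trans ?_
    have hK1 : K ≤ Real.exp (c * u / 2) := by
      calc K ≤ max K 1 := le_max_left _ _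
        _ = Real.exp (Real.log (max K 1)) := (Real.exp_log (by positivity)).symm
        _ ≤ _ := Real.exp_le_exp.mpr (by nlinarith)
    calc _ ≤ Real.exp (c * u / 2) * Real.exp (-(c * u)) := by gcongr
      _ = Real.exp (-(c / 2 * u)) := by rw [← Real.exp_add]; ring_nf
      _ ≤ _ := by
        apply Real.exp_le_exp.mpr
        have : min (c / 2) (δ / s₀) * u ≤ c / 2 * u := by gcongr; exact min_le_left _ _
        linarith
  · refine (avg_mono fun l' _ => avg_mono fun l _ => ind_le_ind fun h => ?_).trans
      ((h2 n).trans ?_)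
    · exact_mod_cast ht.trans h
    · have h3 : min (c / 2) (δ / s₀) * u ≤ δ := by
        calc _ ≤ δ / s₀ * s₀ := by gcongr; exact min_le_right _ _
          _ = δ := by field_simp
      linarith [Real.add_one_le_exp (-(min (c / 2) (δ / s₀) * u))]

/-! ### The walk killed outside a finite set -/

/-- The transition probabilities to `z` of the walk killed outside `B`. -/
def kern (B : Finset (Fin d → ℤ)) (z : Fin d → ℤ) : ℕ → (Fin d → ℤ) → ℝ
  | 0 => fun x => if x = z then 1 else 0
  | j + 1 => fun x => if x ∈ B then mean (kern B z j) x else 0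

/-- `h` is a positive eigenfunction for the walk killed outside `B`, with eigenvalue `lam`. -/
structure IsGround (B : Finset (Fin d → ℤ)) (h : (Fin d → ℤ) → ℝ) (lam : ℝ) : Prop where
  pos_of_mem : ∀ x ∈ B, 0 < h x
  eq_zero : ∀ x ∉ B, h x = 0
  mean_eq : ∀ x ∈ B, mean h x = lam * h x
  le_one : ∀ x, h x ≤ 1
  lam_pos : 0 < lam

variable {B : Finset (Fin d → ℤ)} {h : (Fin d → ℤ) → ℝ} {lam : ℝ}

theorem IsGround.nonneg (H : IsGround B h lam) (x : Fin d → ℤ) : 0 ≤ h x := by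
  by_cases hx : x ∈ B
  · exact (H.pos_of_mem x hx).le
  · exact (H.eq_zero x hx).ge

theorem mean_nonneg {f : (Fin d → ℤ) → ℝ} (hf : ∀ y, 0 ≤ f y) (x : Fin d → ℤ) : 0 ≤ mean f x :=
  div_nonneg (Finset.sum_nonneg fun e _ => hf _) (by positivity)

theorem kern_nonneg (z : Fin d → ℤ) (j : ℕ) (x : Fin d → ℤ) : 0 ≤ kern B z j x := by
  induction j generalizing x with
  | zero => simp only [kern]; split_ifs <;> norm_num
  | succ j ih =>
    simp only [kern]
    split_ifs
    · exact mean_nonneg ih x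
    · exact le_rfl

theorem kern_eq_zero {z : Fin d → ℤ} (hz : z ∈ B) (j : ℕ) {x : Fin d → ℤ} (hx : x ∉ B) :
    kern B z j x = 0 := by
  cases j with
  | zero =>
    have : x ≠ z := by rintro rfl; exact hx hz
    simp [kern, this]
  | succ j => simp [kern, hx]

theorem kern_le_heat (z : Fin d → ℤ) (j : ℕ) (x : Fin d → ℤ) : kern B z j x ≤ heat j (x - z) := by
  induction j generalizing x with
  | zero => simp [kern, heat, sub_eq_zero]
  | succ j ih =>
    simp only [kern]
    split_ifs
    · rw [heat, ← mean_shift]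
      exact mean_mono ih
    · exact heat_nonneg _ _

theorem sum_mul_mean_comm {u v : (Fin d → ℤ) → ℝ} (hu : ∀ x ∉ B, u x = 0)
    (hv : ∀ x ∉ B, v x = 0) :
    ∑ x ∈ B, u x * mean v x = ∑ x ∈ B, mean u x * v x := by
  have key : ∀ e : Step d,
      ∑ x ∈ B, u x * v (x + vec e) = ∑ x ∈ B, u (x + vec (e.1, !e.2)) * v x := by
    intro e
    rw [← tsum_eq_sum (L := SummationFilter.unconditional _)
        (f := fun x => u x * v (x + vec e)) fun x hx => by rw [hu x hx, zero_mul],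
      ← tsum_eq_sum (L := SummationFilter.unconditional _)
        (f := fun x => u (x + vec (e.1, !e.2)) * v x) fun x hx => by
        rw [hv x hx, mul_zero],
      ← (Equiv.addRight (vec e)).tsum_eq fun x => u (x + vec (e.1, !e.2)) * v x]
    refine tsum_congr fun x => ?_
    rw [vec_flip]
    simp
  simp only [mean, mul_div_assoc', div_mul_eq_mul_div, Finset.mul_sum, Finset.sum_mul]
  rw [← Finset.sum_div, ← Finset.sum_div, Finset.sum_comm, Finset.sum_comm (s := B)]
  congr 1
  simp_rw [key]
  exact Fintype.sum_equiv ((Equiv.refl _).prodCongr Equiv.boolNot) _ _ fun e => rfl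

theorem sum_kern_mul_kern {z : Fin d → ℤ} (hz : z ∈ B) (i j : ℕ) :
    ∑ x ∈ B, kern B z i x * kern B z j x = kern B z (i + j) z := by
  induction i generalizing j with
  | zero => simp [kern, hz]
  | succ i ih =>
    rw [add_assoc, add_comm 1 j, ← ih (j + 1)]
    have h1 : ∑ x ∈ B, kern B z (i + 1) x * kern B z j x
        = ∑ x ∈ B, mean (kern B z i) x * kern B z j x :=
      Finset.sum_congr rfl fun x hx => by simp [kern, hx]
    have h2 : ∑ x ∈ B, kern B z i x * kern B z (j + 1) x
        = ∑ x ∈ B, kern B z i x * mean (kern B z j) x :=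
      Finset.sum_congr rfl fun x hx => by simp [kern, hx]
    rw [h1, h2, sum_mul_mean_comm (fun x hx => kern_eq_zero hz _ hx)
      fun x hx => kern_eq_zero hz _ hx]

theorem IsGround.sum_mean_sq_le (H : IsGround B h lam) {f : (Fin d → ℤ) → ℝ}
    (hf : ∀ x ∉ B, f x = 0) :
    ∑ x ∈ B, mean f x ^ 2 ≤ lam ^ 2 * ∑ x ∈ B, f x ^ 2 := by
  have hne : ∀ x, f x ≠ 0 → h x ≠ 0 := fun x hx => by
    by_cases hxB : x ∈ B
    · exact (H.pos_of_mem x hxB).ne'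
    · exact absurd (hf x hxB) hx
  have h1 : ∀ x ∈ B, mean f x ^ 2 ≤ lam * (h x * mean (fun y => f y ^ 2 / h y) x) := by
    intro x hx
    rw [← mul_assoc, ← H.mean_eq x hx]
    simp only [mean]
    rw [div_pow, div_mul_div_comm, sq (2 * (d : ℝ))]
    gcongr
    refine Finset.sum_sq_le_sum_mul_sum_of_sq_le_mul _ (fun e _ => H.nonneg _)
      (fun e _ => div_nonneg (sq_nonneg _) (H.nonneg _)) fun e _ => ?_
    by_cases h0 : f (x + vec e) = 0
    · simp [h0]
    · rw [mul_div_cancel₀ _ (hne _ h0)]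
  calc _ ≤ ∑ x ∈ B, lam * (h x * mean (fun y => f y ^ 2 / h y) x) := Finset.sum_le_sum h1
    _ = lam * ∑ x ∈ B, mean h x * (f x ^ 2 / h x) := by
        rw [← Finset.mul_sum, sum_mul_mean_comm H.eq_zero fun x hx => by simp [hf x hx]]
    _ = _ := by
        rw [Finset.mul_sum, Finset.mul_sum]
        refine Finset.sum_congr rfl fun x hx => ?_
        have := (H.pos_of_mem x hx).ne'
        rw [H.mean_eq x hx]
        field_simp

/-- The return probabilities of the walk conditioned to stay in `B`. -/
def tiltRet (B : Finset (Fin d → ℤ)) (lam : ℝ) (z : Fin d → ℤ) (j : ℕ) : ℝ :=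
  (lam ^ j)⁻¹ * kern B z j z

theorem IsGround.kern_even_le (H : IsGround B h lam) {z : Fin d → ℤ} (hz : z ∈ B) (m : ℕ) :
    kern B z (m + 1 + (m + 1)) z ≤ lam ^ 2 * kern B z (m + m) z := by
  rw [← sum_kern_mul_kern hz, ← sum_kern_mul_kern hz]
  have := H.sum_mean_sq_le (f := kern B z m) fun x hx => kern_eq_zero hz _ hx
  simp only [← sq]
  refine le_trans (le_of_eq (Finset.sum_congr rfl fun x hx => ?_)) this
  simp [kern, hx]

theorem IsGround.kern_odd_le (H : IsGround B h lam) {z : Fin d → ℤ} (hz : z ∈ B) (m : ℕ) :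
    kern B z (m + (m + 1)) z ≤ lam * kern B z (m + m) z := by
  have hl := H.lam_pos
  have h1 := H.kern_even_le hz m
  have h2 : 2 * lam * kern B z (m + (m + 1)) z ≤
      lam ^ 2 * kern B z (m + m) z + kern B z (m + 1 + (m + 1)) z := by
    rw [← sum_kern_mul_kern hz, ← sum_kern_mul_kern hz, ← sum_kern_mul_kern hz, Finset.mul_sum,
      Finset.mul_sum, ← Finset.sum_add_distrib]
    refine Finset.sum_le_sum fun x _ => ?_
    nlinarith [sq_nonneg (lam * kern B z m x - kern B z (m + 1) x)]
  nlinarith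

theorem IsGround.tiltRet_le (H : IsGround B h lam) {z : Fin d → ℤ} (hz : z ∈ B) {m j : ℕ}
    (hj : 2 * m ≤ j) : tiltRet B lam z j ≤ tiltRet B lam z (2 * m) := by
  have hl := H.lam_pos
  have heven : ∀ p, m ≤ p → tiltRet B lam z (2 * p) ≤ tiltRet B lam z (2 * m) := by
    intro p hp
    induction p, hp using Nat.le_induction with
    | base => exact le_rfl
    | succ p _ ih =>
      refine le_trans ?_ ih
      have := H.kern_even_le hz p
      rw [show p + 1 + (p + 1) = 2 * (p + 1) by ring, show p + p = 2 * p by ring] at this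
      simp only [tiltRet]
      calc _ ≤ (lam ^ (2 * (p + 1)))⁻¹ * (lam ^ 2 * kern B z (2 * p) z) := by gcongr
        _ = _ := by
          rw [mul_add, pow_add]
          field_simp
  rcases Nat.even_or_odd' j with ⟨p, rfl | rfl⟩
  · exact heven p (by omega)
  · refine le_trans ?_ (heven p (by omega))
    have := H.kern_odd_le hz p
    rw [show p + (p + 1) = 2 * p + 1 by ring, show p + p = 2 * p by ring] at this
    simp only [tiltRet]
    calc _ ≤ (lam ^ (2 * p + 1))⁻¹ * (lam * kern B z (2 * p) z) := by gcongr
      _ = _ := by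
        rw [pow_succ]
        field_simp

/-! ### The walk conditioned to stay in a finite set -/

/-- Density of the walk conditioned to stay in `B` (up to `h x`), with respect to the simple
random walk. -/
def dens (B : Finset (Fin d → ℤ)) (h : (Fin d → ℤ) → ℝ) (lam : ℝ) :
    (Fin d → ℤ) → List (Step d) → ℝ
  | x, [] => h x
  | x, e :: l => if x ∈ B then lam⁻¹ * dens B h lam (x + vec e) l else 0

/-- The probability that the conditioned walk visits `z` (up to `h x`). -/
def hit (B : Finset (Fin d → ℤ)) (h : (Fin d → ℤ) → ℝ) (lam : ℝ) (n : ℕ) (x z : Fin d → ℤ) : ℝ :=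
  avg n fun l => dens B h lam x l * if z ∈ rng x l then 1 else 0

theorem IsGround.dens_nonneg (H : IsGround B h lam) (x : Fin d → ℤ) (l : List (Step d)) :
    0 ≤ dens B h lam x l := by
  have hl := H.lam_pos
  induction l generalizing x with
  | nil => exact H.nonneg x
  | cons e l ih =>
    simp only [dens]
    split_ifs
    · exact mul_nonneg (by positivity) (ih _)
    · exact le_rfl

theorem IsGround.dens_le (H : IsGround B h lam) (x : Fin d → ℤ) (l : List (Step d)) :
    dens B h lam x l ≤ (lam ^ l.length)⁻¹ := by
  have hl := H.lam_pos
  induction l generalizing x with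
  | nil => simpa [dens] using H.le_one x
  | cons e l ih =>
    simp only [dens]
    split_ifs
    · rw [List.length_cons, pow_succ, mul_inv, mul_comm _ lam⁻¹]
      gcongr
      exact ih _
    · positivity

theorem IsGround.dens_eq_zero (H : IsGround B h lam) {x : Fin d → ℤ} (hx : x ∉ B)
    (l : List (Step d)) : dens B h lam x l = 0 := by
  cases l with
  | nil => exact H.eq_zero x hx
  | cons e l => simp [dens, hx]

theorem IsGround.avg_dens (H : IsGround B h lam) (n : ℕ) (x : Fin d → ℤ) :
    avg n (dens B h lam x) = h x := by
  have hl := H.lam_pos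
  induction n generalizing x with
  | zero => rfl
  | succ n ih =>
    by_cases hx : x ∈ B
    · simp only [avg, dens, hx, if_true, avg_const_mul]
      have : ∀ e, avg n (fun l => dens B h lam (x + vec e) l) = h (x + vec e) := fun e => ih _
      simp only [this]
      rw [← Finset.mul_sum, mul_div_assoc]
      have := H.mean_eq x hx
      rw [mean] at this
      rw [this]
      field_simp
    · simp only [avg, H.dens_eq_zero hx, H.eq_zero x hx]
      have := avg_const_mul (d := d) n 0 fun _ => 0
      simp only [zero_mul] at this
      simp [this]

theorem rng_self_mem (x : Fin d → ℤ) (l : List (Step d)) : x ∈ rng x l :=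
  mem_rng.mpr ⟨0, by omega, pos_zero _ _⟩

theorem IsGround.hit_self (H : IsGround B h lam) (n : ℕ) (x : Fin d → ℤ) :
    hit B h lam n x x = h x := by
  simp only [hit, rng_self_mem, if_true, mul_one]
  exact H.avg_dens n x

theorem hit_succ {x z : Fin d → ℤ} (hx : x ∈ B) (hxz : z ≠ x) (n : ℕ) :
    hit B h lam (n + 1) x z = lam⁻¹ * mean (fun y => hit B h lam n y z) x := by
  simp only [hit, avg, dens, hx, if_true, rng_cons, Finset.mem_insert, hxz, false_or, mean,
    mul_assoc, avg_const_mul]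
  rw [← Finset.mul_sum, mul_div_assoc]

theorem IsGround.hit_nonneg (H : IsGround B h lam) (n : ℕ) (x z : Fin d → ℤ) :
    0 ≤ hit B h lam n x z :=
  avg_nonneg fun l => mul_nonneg (H.dens_nonneg _ _) (by split_ifs <;> norm_num)

theorem IsGround.sum_tilt_kern_le (H : IsGround B h lam) {z : Fin d → ℤ} (hz : z ∈ B) (n : ℕ)
    (x : Fin d → ℤ) :
    ∑ j ∈ Finset.range (n + 1), (lam ^ j)⁻¹ * kern B z j x * h z ≤
      hit B h lam n x z * ∑ j ∈ Finset.range (n + 1), tiltRet B lam z j := by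
  have hl := H.lam_pos
  have hret : ∀ j, 0 ≤ tiltRet B lam z j := fun j =>
    mul_nonneg (by positivity) (kern_nonneg _ _ _)
  have hret' : ∀ n, 0 ≤ ∑ j ∈ Finset.range n, tiltRet B lam z j := fun n =>
    Finset.sum_nonneg fun j _ => hret j
  by_cases hx : x ∈ B
  swap
  · simp only [kern_eq_zero hz _ hx, mul_zero, zero_mul, Finset.sum_const_zero]
    exact mul_nonneg (H.hit_nonneg _ _ _) (hret' _)
  by_cases hxz : z = x
  · subst hxz
    rw [H.hit_self, mul_comm, Finset.sum_mul]
    exact le_rfl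
  induction n generalizing x with
  | zero =>
    have : kern B z 0 x = 0 := by simp [kern, Ne.symm hxz]
    simp only [zero_add, Finset.sum_range_one, this, mul_zero, zero_mul]
    exact mul_nonneg (H.hit_nonneg _ _ _) (hret _)
  | succ n ih =>
    have ih' : ∀ y, ∑ j ∈ Finset.range (n + 1), (lam ^ j)⁻¹ * kern B z j y * h z ≤
        hit B h lam n y z * ∑ j ∈ Finset.range (n + 1), tiltRet B lam z j := by
      intro y
      by_cases hy : y ∈ B
      swap
      · simp only [kern_eq_zero hz _ hy, mul_zero, zero_mul, Finset.sum_const_zero]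
        exact mul_nonneg (H.hit_nonneg _ _ _) (hret' _)
      by_cases hyz : z = y
      · subst hyz
        rw [H.hit_self, mul_comm, Finset.sum_mul]
        exact le_rfl
      · exact ih y hy hyz
    have h0 : kern B z 0 x = 0 := by simp [kern, Ne.symm hxz]
    rw [Finset.sum_range_succ', h0, mul_zero, zero_mul, add_zero, hit_succ hx hxz]
    calc _ = lam⁻¹ * mean (fun y => ∑ j ∈ Finset.range (n + 1),
          (lam ^ j)⁻¹ * kern B z j y * h z) x := by
          rw [mean_sum, Finset.mul_sum]
          refine Finset.sum_congr rfl fun j _ => ?_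
          have : (fun y => (lam ^ j)⁻¹ * kern B z j y * h z)
              = fun y => ((lam ^ j)⁻¹ * h z) * kern B z j y := by ext y; ring
          rw [this, mean_const_mul, pow_succ]
          simp only [kern, hx, if_true]
          field_simp
      _ ≤ lam⁻¹ * mean (fun y => (∑ j ∈ Finset.range (n + 1), tiltRet B lam z j) *
          hit B h lam n y z) x := by
          gcongr
          exact mean_mono fun y => (ih' y).trans_eq (mul_comm _ _)
      _ = lam⁻¹ * mean (fun y => hit B h lam n y z) x *
          ∑ j ∈ Finset.range (n + 1), tiltRet B lam z j := by
          rw [mean_const_mul]; ring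
      _ ≤ _ := by
          refine mul_le_mul_of_nonneg_left ?_
            (mul_nonneg (by positivity) (mean_nonneg (fun y => H.hit_nonneg _ _ _) _))
          rw [Finset.sum_range_succ _ (n + 1)]
          linarith [hret (n + 1)]

theorem IsGround.sum_kern_mul (H : IsGround B h lam) (j : ℕ) (x : Fin d → ℤ) :
    ∑ z ∈ B, kern B z j x * h z = lam ^ j * h x := by
  induction j generalizing x with
  | zero =>
    simp only [kern, ite_mul, one_mul, zero_mul, Finset.sum_ite_eq, pow_zero]
    split_ifs with hx
    · rfl
    · exact (H.eq_zero x hx).symm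
  | succ j ih =>
    by_cases hx : x ∈ B
    · simp only [kern, hx, if_true]
      calc _ = mean (fun y => ∑ z ∈ B, kern B z j y * h z) x := by
            rw [mean_sum]
            refine Finset.sum_congr rfl fun z _ => ?_
            simp_rw [mul_comm _ (h z)]
            rw [mean_const_mul]
        _ = _ := by
            simp_rw [ih]
            rw [mean_const_mul, H.mean_eq x hx, pow_succ]
            ring
    · simp [kern, hx, H.eq_zero x hx]

/-- If returns are uniformly bounded, the conditioned walk visits many sites. -/
theorem IsGround.le_sum_hit (H : IsGround B h lam) {n : ℕ} {G : ℝ} (x : Fin d → ℤ)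
    (hG : ∀ z ∈ B, ∑ j ∈ Finset.range (n + 1), tiltRet B lam z j ≤ G) :
    (n + 1) * h x ≤ (∑ z ∈ B, hit B h lam n x z) * G := by
  have hl := H.lam_pos
  calc ((n : ℝ) + 1) * h x = ∑ z ∈ B, ∑ j ∈ Finset.range (n + 1),
        (lam ^ j)⁻¹ * kern B z j x * h z := by
        rw [Finset.sum_comm]
        simp_rw [mul_assoc, ← Finset.mul_sum, H.sum_kern_mul]
        have : ∀ j : ℕ, (lam ^ j)⁻¹ * (lam ^ j * h x) = h x := fun j => by field_simp
        simp [this]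
    _ ≤ ∑ z ∈ B, hit B h lam n x z * G := by
        refine Finset.sum_le_sum fun z hz => (H.sum_tilt_kern_le hz n x).trans ?_
        exact mul_le_mul_of_nonneg_left (hG z hz) (H.hit_nonneg _ _ _)
    _ = _ := by rw [Finset.sum_mul]

/-! ### Ground state of a box -/

/-- The box of sites with coordinates of absolute value less than `N`. -/
def box (d N : ℕ) : Finset (Fin d → ℤ) := Fintype.piFinset fun _ => Finset.Ioo (-(N : ℤ)) N

/-- The product of cosines, which is an eigenfunction of the averaging operator. -/
def cosProd (N : ℕ) (x : Fin d → ℤ) : ℝ := ∏ i, Real.cos (Real.pi / (2 * N) * x i)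

/-- The ground state of the walk killed outside the box. -/
def ground (N : ℕ) (x : Fin d → ℤ) : ℝ := if x ∈ box d N then cosProd N x else 0

/-- The eigenvalue of the ground state of the box. -/
def eig (N : ℕ) : ℝ := Real.cos (Real.pi / (2 * N))

theorem mem_box {N : ℕ} {x : Fin d → ℤ} : x ∈ box d N ↔ ∀ i, -(N : ℤ) < x i ∧ x i < N := by
  simp [box]

theorem card_box_le (N : ℕ) : ((box d N).card : ℝ) ≤ 2 ^ d * (N : ℝ) ^ d := by
  have : (box d N).card ≤ (2 * N) ^ d := by
    rw [box, Fintype.card_piFinset]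
    simp only [Int.card_Ioo, Finset.prod_const, Finset.card_univ, Fintype.card_fin]
    gcongr
    omega
  rw [← mul_pow]
  exact_mod_cast this

theorem mean_cosProd (hd : 0 < d) (N : ℕ) (x : Fin d → ℤ) :
    mean (cosProd N) x = eig N * cosProd N x := by
  have hd' : (d : ℝ) ≠ 0 := by positivity
  have key : ∀ i : Fin d, cosProd N (x + vec (i, true)) + cosProd N (x + vec (i, false))
      = 2 * (eig N * cosProd N x) := by
    intro i
    have h1 : ∀ b : Bool, cosProd N (x + vec (i, b))
        = Real.cos (Real.pi / (2 * N) * (x + vec (i, b)) i) *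
          ∏ j ∈ {i}ᶜ, Real.cos (Real.pi / (2 * N) * x j) := by
      intro b
      rw [cosProd, Fintype.prod_eq_mul_prod_compl i]
      congr 1
      refine Finset.prod_congr rfl fun j hj => ?_
      have : j ≠ i := by simpa using hj
      simp [vec, this]
    rw [h1, h1, cosProd, Fintype.prod_eq_mul_prod_compl i, eig]
    simp only [vec, Pi.add_apply, Pi.single_eq_same]
    push_cast
    simp only [mul_add, Real.cos_add, mul_neg, mul_one, Real.cos_neg, Real.sin_neg]
    ring
  rw [mean, Fintype.sum_prod_type]
  simp only [Fintype.sum_bool, key]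
  simp
  field_simp

theorem isGround_box (hd : 0 < d) {N : ℕ} (hN : 2 ≤ N) :
    IsGround (box d N) (ground N) (eig N) := by
  have hN' : (0 : ℝ) < N := by positivity
  have hpi := Real.pi_pos
  have hcos : ∀ x ∈ box d N, ∀ i, 0 < Real.cos (Real.pi / (2 * N) * (x i : ℤ)) := by
    intro x hx i
    obtain ⟨h1, h2⟩ := mem_box.mp hx i
    have h1' : -(N : ℝ) < x i := by exact_mod_cast h1
    have h2' : (x i : ℝ) < N := by exact_mod_cast h2
    apply Real.cos_pos_of_mem_Ioo
    have e1 : Real.pi / (2 * N) * N = Real.pi / 2 := by field_simp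
    have hp : 0 < Real.pi / (2 * N) := by positivity
    constructor <;> nlinarith
  refine ⟨fun x hx => ?_, fun x hx => by simp [ground, hx], fun x hx => ?_, fun x => ?_, ?_⟩
  · rw [ground, if_pos hx]
    exact Finset.prod_pos fun i _ => hcos x hx i
  · rw [ground, if_pos hx, ← mean_cosProd hd, mean, mean]
    congr 1
    refine Finset.sum_congr rfl fun e _ => ?_
    rw [ground]
    split_ifs with he
    · rfl
    · obtain ⟨i, hi⟩ : ∃ i, ¬ (-(N : ℤ) < (x + vec e) i ∧ (x + vec e) i < N) := by
        by_contra h0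
        push Not at h0
        exact he (mem_box.mpr h0)
      obtain ⟨h1, h2⟩ := mem_box.mp hx i
      have h3 : |vec e i| ≤ 1 := by
        rcases eq_or_ne i e.1 with rfl | hne
        · rcases e.2 with _ | _ <;> simp [vec] <;> split_ifs <;> simp
        · simp [vec, hne]
      rw [abs_le] at h3
      rw [Pi.add_apply] at hi
      symm
      apply Finset.prod_eq_zero (Finset.mem_univ i)
      rw [Pi.add_apply]
      have h4 : x i + vec e i = N ∨ x i + vec e i = -N := by omega
      rcases h4 with h4 | h4 <;> rw [h4]
      · have : Real.pi / (2 * N) * ((N : ℤ) : ℝ) = Real.pi / 2 := by push_cast; field_simp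
        rw [this, Real.cos_pi_div_two]
      · have : Real.pi / (2 * N) * ((-N : ℤ) : ℝ) = -(Real.pi / 2) := by push_cast; field_simp
        rw [this, Real.cos_neg, Real.cos_pi_div_two]
  · rw [ground]
    split_ifs with hx
    · exact Finset.prod_le_one (fun i _ => (hcos x hx i).le) fun i _ => Real.cos_le_one _
    · norm_num
  · apply Real.cos_pos_of_mem_Ioo
    constructor
    · have : 0 < Real.pi / (2 * N) := by positivity
      linarith
    · apply div_lt_div_of_pos_left hpi (by norm_num)
      have : (2 : ℝ) ≤ N := by exact_mod_cast hN
      linarith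

theorem ground_zero {N : ℕ} (hN : 2 ≤ N) : ground N (0 : Fin d → ℤ) = 1 := by
  have : (0 : Fin d → ℤ) ∈ box d N := mem_box.mpr fun i => by simp; omega
  simp [ground, this, cosProd]

theorem exp_le_eig {N : ℕ} (hN : 2 ≤ N) : Real.exp (-(4 / (N : ℝ) ^ 2)) ≤ eig N := by
  have hN' : (2 : ℝ) ≤ N := by exact_mod_cast hN
  have h1 := Real.one_sub_sq_div_two_le_cos (x := Real.pi / (2 * N))
  have hpi : Real.pi ^ 2 ≤ 16 := by nlinarith [Real.pi_pos, Real.pi_lt_four]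
  set y : ℝ := 2 / (N : ℝ) ^ 2 with hy
  have hy0 : 0 ≤ y := by positivity
  have hy1 : y ≤ 1 / 2 := by
    rw [hy, div_le_div_iff₀ (by positivity) (by norm_num)]
    nlinarith
  have h2 : (Real.pi / (2 * N)) ^ 2 / 2 ≤ y := by
    rw [hy, div_pow, div_div, div_le_div_iff₀ (by positivity) (by positivity)]
    nlinarith [sq_nonneg (N : ℝ)]
  have h3 : Real.exp (-(2 * y)) ≤ 1 - y := by
    rw [Real.exp_neg, inv_le_iff_one_le_mul₀ (Real.exp_pos _)]
    have := Real.add_one_le_exp (2 * y)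
    nlinarith
  have h4 : 4 / (N : ℝ) ^ 2 = 2 * y := by rw [hy]; ring
  rw [h4, eig]
  linarith

theorem exp_le_eig_pow {N : ℕ} (hN : 2 ≤ N) (j : ℕ) :
    Real.exp (-(4 * j / (N : ℝ) ^ 2)) ≤ eig N ^ j := by
  have := pow_le_pow_left₀ (Real.exp_pos _).le (exp_le_eig hN) j
  rw [← Real.exp_nat_mul] at this
  refine le_trans (le_of_eq ?_) this
  congr 1
  ring

/-- Bound on the expected number of returns of the walk conditioned to stay in a box. -/
def retConst (d : ℕ) : ℝ := Real.exp 8 * heatConst d * (tailConst ((d : ℝ) / 2) + 2)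

theorem retConst_pos (hd : 5 ≤ d) : 0 < retConst d := by
  have := heatConst_pos (d := d) (by omega)
  have := tailConst_pos (half_dim_gt_one hd)
  unfold retConst
  positivity

theorem sum_tiltRet_le (hd : 5 ≤ d) {N : ℕ} (hN : 2 ≤ N) {z : Fin d → ℤ} (hz : z ∈ box d N) :
    ∑ j ∈ Finset.range (N ^ d + 1), tiltRet (box d N) (eig N) z j ≤ retConst d := by
  have H := isGround_box (d := d) (by omega) hN
  have hl := H.lam_pos
  have hc := heatConst_pos (d := d) (by omega)
  have hN0 : (0 : ℝ) < N := by positivity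
  have early : ∀ j, j ≤ 2 * N ^ 2 → tiltRet (box d N) (eig N) z j ≤
      Real.exp 8 * heatConst d * ((j : ℝ) + (1 : ℕ)) ^ (-((d : ℝ) / 2)) := by
    intro j hj
    rw [tiltRet, mul_assoc]
    have h1 : (eig N ^ j)⁻¹ ≤ Real.exp 8 := by
      rw [inv_le_comm₀ (by positivity) (Real.exp_pos _), ← Real.exp_neg]
      refine le_trans (Real.exp_le_exp.mpr ?_) (exp_le_eig_pow hN j)
      rw [neg_le_neg_iff, div_le_iff₀ (by positivity)]
      have : (j : ℝ) ≤ 2 * N ^ 2 := by exact_mod_cast hj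
      linarith
    have h2 := (kern_le_heat (B := box d N) z j z).trans (heat_le_rpow (by omega) j _)
    rw [Nat.cast_one]
    exact mul_le_mul h1 h2 (kern_nonneg _ _ _) (Real.exp_pos _).le
  have late : ∀ j, 2 * N ^ 2 ≤ j → tiltRet (box d N) (eig N) z j ≤
      Real.exp 8 * heatConst d * ((N : ℝ) ^ d)⁻¹ := by
    intro j hj
    refine (H.tiltRet_le hz hj).trans ((early _ le_rfl).trans ?_)
    refine mul_le_mul_of_nonneg_left ?_ (by positivity)
    have : ((N : ℝ) ^ d)⁻¹ = ((N : ℝ) ^ 2) ^ (-((d : ℝ) / 2)) := by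
      rw [← Real.rpow_natCast N 2, ← Real.rpow_mul hN0.le, ← Real.rpow_natCast,
        ← Real.rpow_neg hN0.le]
      congr 1
      push_cast
      ring
    rw [this]
    apply Real.rpow_le_rpow_of_nonpos (by positivity) _ (by linarith [half_dim_gt_one hd])
    push_cast
    nlinarith [sq_nonneg (N : ℝ)]
  have all : ∀ j, tiltRet (box d N) (eig N) z j ≤
      Real.exp 8 * heatConst d * ((j : ℝ) + (1 : ℕ)) ^ (-((d : ℝ) / 2)) +
      Real.exp 8 * heatConst d * ((N : ℝ) ^ d)⁻¹ := by
    intro j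
    rcases le_total j (2 * N ^ 2) with hj | hj
    · exact (early j hj).trans (le_add_of_nonneg_right (by positivity))
    · exact (late j hj).trans (le_add_of_nonneg_left (by positivity))
  refine (Finset.sum_le_sum fun j _ => all j).trans ?_
  have ht := sum_rpow_neg_le (half_dim_gt_one hd) le_rfl (N ^ d + 1)
  rw [Nat.cast_one, Real.one_rpow, mul_one] at ht
  rw [Finset.sum_add_distrib, ← Finset.mul_sum, Finset.sum_const, Finset.card_range, nsmul_eq_mul]
  have h2 : ((N ^ d + 1 : ℕ) : ℝ) * ((N : ℝ) ^ d)⁻¹ ≤ 2 := by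
    have : (1 : ℝ) ≤ (N : ℝ) ^ d := one_le_pow₀ (by exact_mod_cast (by omega : 1 ≤ N))
    rw [← div_eq_mul_inv, div_le_iff₀ (by positivity)]
    push_cast
    linarith
  calc _ ≤ Real.exp 8 * heatConst d * tailConst ((d : ℝ) / 2) + Real.exp 8 * heatConst d * 2 := by
        rw [mul_left_comm]
        simp only [Nat.cast_one]
        gcongr
    _ = _ := by rw [retConst]; ring

/-! ### Lower tail of the intersection of several ranges -/

theorem avg_eq_sum (n : ℕ) (F : List (Step d) → ℝ) :
    avg n F = (∑ v : Fin n → Step d, F (List.ofFn v)) / (2 * d) ^ n := by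
  induction n generalizing F with
  | zero => simp [avg]
  | succ n ih =>
    simp only [avg, ih]
    rw [← Finset.sum_div, div_div, ← pow_succ, ← Fintype.sum_prod_type']
    congr 1
    refine Fintype.sum_equiv (Fin.consEquiv fun _ => Step d) _ _ fun p => ?_
    simp [Fin.consEquiv, List.ofFn_succ]

/-- The number of families of `k` paths of length `n` with more than `t` common sites. -/
def manyCount (d k n : ℕ) (t : ℝ) : ℝ :=
  ∑ V : Fin k → Fin n → Step d, if ∃ A : Finset (Fin d → ℤ), t < (A.card : ℝ) ∧
    ∀ z ∈ A, ∀ i, z ∈ rng 0 (List.ofFn (V i)) then 1 else 0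

theorem sum_prod_eq_pow {α : Type*} [Fintype α] (k : ℕ) (f : α → ℝ) :
    ∑ V : Fin k → α, ∏ i, f (V i) = (∑ v, f v) ^ k := (Fintype.sum_pow f k).symm

theorem IsGround.sum_hit_pow_le {B : Finset (Fin d → ℤ)} {h : (Fin d → ℤ) → ℝ} {lam : ℝ}
    (H : IsGround B h lam) (hd : 0 < d) (h0 : h 0 = 1) (k n : ℕ) {t : ℝ} (ht : 0 ≤ t) :
    ∑ z ∈ B, hit B h lam n 0 z ^ k ≤
      t + B.card * ((lam ^ n)⁻¹) ^ k * (manyCount d k n t / ((2 * d) ^ n) ^ k) := by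
  have hl := H.lam_pos
  have hd' : (0 : ℝ) < d := by exact_mod_cast hd
  set Q : ℝ := (2 * d) ^ n with hQ
  have hQ0 : 0 < Q := by positivity
  let D : (Fin n → Step d) → ℝ := fun v => dens B h lam 0 (List.ofFn v)
  let A : (Fin k → Fin n → Step d) → Finset (Fin d → ℤ) := fun V =>
    B.filter fun z => ∀ i, z ∈ rng 0 (List.ofFn (V i))
  have hD0 : ∀ v, 0 ≤ D v := fun v => H.dens_nonneg _ _
  have hD1 : ∀ v, D v ≤ (lam ^ n)⁻¹ := fun v => by
    have := H.dens_le 0 (List.ofFn v)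
    rwa [List.length_ofFn] at this
  have s1 : ∑ V : Fin k → Fin n → Step d, (∏ i, D (V i)) * ((A V).card : ℝ)
      = Q ^ k * ∑ z ∈ B, hit B h lam n 0 z ^ k := by
    have e1 : ∀ V, ((A V).card : ℝ)
        = ∑ z ∈ B, ∏ i, if z ∈ rng 0 (List.ofFn (V i)) then (1 : ℝ) else 0 := by
      intro V
      simp only [A, Finset.card_filter, Finset.prod_boole]
      push_cast
      simp
    simp_rw [e1, Finset.mul_sum, ← Finset.prod_mul_distrib]
    rw [Finset.sum_comm]
    refine Finset.sum_congr rfl fun z _ => ?_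
    rw [sum_prod_eq_pow k fun v => D v * if z ∈ rng 0 (List.ofFn v) then (1 : ℝ) else 0, hit,
      avg_eq_sum, ← mul_pow, mul_div_cancel₀ _ hQ0.ne']
  have s2 : ∑ V : Fin k → Fin n → Step d, (∏ i, D (V i)) = Q ^ k := by
    have := H.avg_dens n 0
    rw [avg_eq_sum, h0, div_eq_one_iff_eq hQ0.ne'] at this
    rw [sum_prod_eq_pow, this]
  have s3 : ∑ V : Fin k → Fin n → Step d, (∏ i, D (V i)) * ((A V).card : ℝ)
      ≤ Q ^ k * t + B.card * ((lam ^ n)⁻¹) ^ k * manyCount d k n t := by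
    rw [← s2, Finset.sum_mul, manyCount, Finset.mul_sum, ← Finset.sum_add_distrib]
    refine Finset.sum_le_sum fun V _ => ?_
    have p0 : 0 ≤ ∏ i, D (V i) := Finset.prod_nonneg fun i _ => hD0 _
    have p1 : ∏ i, D (V i) ≤ ((lam ^ n)⁻¹) ^ k := by
      calc _ ≤ ∏ _i : Fin k, (lam ^ n)⁻¹ := Finset.prod_le_prod (fun i _ => hD0 _) fun i _ => hD1 _
        _ = _ := by simp
    have p2 : ((A V).card : ℝ) ≤ B.card := by exact_mod_cast Finset.card_filter_le _ _
    by_cases hV : t < ((A V).card : ℝ)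
    · rw [if_pos ⟨A V, hV, fun z hz => (Finset.mem_filter.mp hz).2⟩, mul_one]
      have : (∏ i, D (V i)) * ((A V).card : ℝ) ≤ ((lam ^ n)⁻¹) ^ k * B.card := by gcongr
      nlinarith
    · push Not at hV
      refine (mul_le_mul_of_nonneg_left hV p0).trans (le_add_of_nonneg_right ?_)
      exact mul_nonneg (by positivity) (by split_ifs <;> norm_num)
  rw [s1] at s3
  rw [mul_div_assoc', ← sub_le_iff_le_add', le_div_iff₀ (by positivity)]
  linarith

theorem exists_exp_le_manyCount (hd : 5 ≤ d) {k : ℕ} (hk : 1 ≤ k) :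
    ∃ η > 0, ∀ (N : ℕ) (t : ℝ), 2 ≤ N → 0 ≤ t → t ≤ η * (N : ℝ) ^ d →
      η * Real.exp (-(4 * k * (N : ℝ) ^ (d - 2))) ≤
        manyCount d k (N ^ d) t / ((2 * d) ^ (N ^ d)) ^ k := by
  have hG := retConst_pos hd
  obtain ⟨k, rfl⟩ : ∃ m, k = m + 1 := ⟨k - 1, by omega⟩
  set θ : ℝ := (retConst d ^ (k + 1) * (2 ^ d) ^ k)⁻¹ with hθ
  have hθ0 : 0 < θ := by positivity
  have h2d : (1 : ℝ) ≤ 2 ^ d := one_le_pow₀ (by norm_num)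
  refine ⟨θ / 2 / 2 ^ d, by positivity, fun N t hN ht0 ht => ?_⟩
  have H := isGround_box (d := d) (by omega) hN
  have hl := H.lam_pos
  have hN0 : (0 : ℝ) < N := by positivity
  set n := N ^ d with hn
  have hnR : (n : ℝ) = (N : ℝ) ^ d := by rw [hn]; push_cast; rfl
  have hc := card_box_le (d := d) N
  have hc0 : (0 : ℝ) < (box d N).card := by
    have : (0 : Fin d → ℤ) ∈ box d N := mem_box.mpr fun i => by simp; omega
    exact_mod_cast Finset.card_pos.mpr ⟨0, this⟩
  have h1 := H.sum_hit_pow_le (by omega) (ground_zero hN) (k + 1) n ht0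
  have h2 := H.le_sum_hit (n := n) 0 fun z hz => sum_tiltRet_le hd hN hz
  rw [ground_zero hN, mul_one] at h2
  have h3 := pow_sum_div_card_le_sum_pow (s := box d N)
    (f := fun z => hit (box d N) (ground N) (eig N) n 0 z) (fun z _ => H.hit_nonneg _ _ _) k
  set S := ∑ z ∈ box d N, hit (box d N) (ground N) (eig N) n 0 z with hS
  set p := manyCount d (k + 1) n t / ((2 * d) ^ n) ^ (k + 1) with hp
  have hp0 : 0 ≤ p := by
    rw [hp, manyCount]
    exact div_nonneg (Finset.sum_nonneg fun V _ => by split_ifs <;> norm_num) (by positivity)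
  have h4 : (N : ℝ) ^ d * θ ≤ S ^ (k + 1) / ((box d N).card : ℝ) ^ k := by
    have hS1 : (N : ℝ) ^ d / retConst d ≤ S := by
      rw [div_le_iff₀ hG]
      linarith
    calc (N : ℝ) ^ d * θ = ((N : ℝ) ^ d / retConst d) ^ (k + 1) / (2 ^ d * (N : ℝ) ^ d) ^ k := by
          rw [hθ, div_pow, mul_pow, pow_succ ((N : ℝ) ^ d)]
          field_simp
      _ ≤ _ := by
          have hS0 : 0 ≤ S := le_trans (by positivity) hS1
          gcongr
  have h5 : t ≤ θ / 2 * (N : ℝ) ^ d :=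
    ht.trans (mul_le_mul_of_nonneg_right (div_le_self (by positivity) h2d) (by positivity))
  have h6 : θ / 2 * (N : ℝ) ^ d ≤ 2 ^ d * (N : ℝ) ^ d * ((eig N ^ n)⁻¹) ^ (k + 1) * p := by
    have : ((box d N).card : ℝ) * ((eig N ^ n)⁻¹) ^ (k + 1) * p ≤
      2 ^ d * (N : ℝ) ^ d * ((eig N ^ n)⁻¹) ^ (k + 1) * p := by gcongr
    linarith
  have h7 : Real.exp (-(4 * ((k + 1 : ℕ) : ℝ) * (N : ℝ) ^ (d - 2))) ≤ (eig N ^ n) ^ (k + 1) := by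
    have := pow_le_pow_left₀ (Real.exp_pos _).le (exp_le_eig_pow hN n) (k + 1)
    rw [← Real.exp_nat_mul] at this
    refine le_trans (le_of_eq ?_) this
    congr 1
    have e : (N : ℝ) ^ d = (N : ℝ) ^ (d - 2) * N ^ 2 := by rw [← pow_add]; congr 1; omega
    rw [hnR, e]
    field_simp
  have h8 : θ / 2 / 2 ^ d * (eig N ^ n) ^ (k + 1) ≤ p := by
    rw [inv_pow] at h6
    have hNd : (0 : ℝ) < (N : ℝ) ^ d := by positivity
    have h9 : θ / 2 ≤ 2 ^ d * ((eig N ^ n) ^ (k + 1))⁻¹ * p := by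
      refine le_of_mul_le_mul_right (h6.trans_eq ?_) hNd
      ring
    calc _ ≤ (2 ^ d * ((eig N ^ n) ^ (k + 1))⁻¹ * p) / 2 ^ d * (eig N ^ n) ^ (k + 1) := by gcongr
      _ = p := by field_simp
  exact (mul_le_mul_of_nonneg_left h7 (by positivity)).trans h8

/-- Lower tail bound for the number of common sites of several finite walks. -/
theorem exp_le_manyCount (hd : 5 ≤ d) {k : ℕ} (hk : 1 ≤ k) :
    ∃ c > 0, ∀ t : ℝ, 1 < t → ∃ n : ℕ, Real.exp (-(c * t ^ (1 - 2 / (d : ℝ)))) ≤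
      manyCount d k n t / ((2 * d) ^ n) ^ k := by
  obtain ⟨η, hη, key⟩ := exists_exp_le_manyCount hd hk
  have hd5 : (5 : ℝ) ≤ d := by exact_mod_cast hd
  have hk' : (1 : ℝ) ≤ k := by exact_mod_cast hk
  set C : ℝ := (1 / η) ^ (1 / (d : ℝ)) + 2 with hC
  have hC0 : 0 < C := by positivity
  refine ⟨4 * k * C ^ (d - 2) + |Real.log η|, by positivity, fun t ht => ?_⟩
  have ht0 : 0 < t := by linarith
  set N : ℕ := ⌈(t / η) ^ (1 / (d : ℝ))⌉₊ + 1 with hN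
  have hr : (0 : ℝ) < (t / η) ^ (1 / (d : ℝ)) := by positivity
  have hN2 : 2 ≤ N := by
    have := Nat.ceil_pos.mpr hr
    omega
  have hN1 : (t / η) ^ (1 / (d : ℝ)) ≤ N := by
    rw [hN]
    push_cast
    linarith [Nat.le_ceil ((t / η) ^ (1 / (d : ℝ)))]
  have ht1 : 1 ≤ t ^ (1 / (d : ℝ)) := Real.one_le_rpow ht.le (by positivity)
  have hN3 : (N : ℝ) ≤ C * t ^ (1 / (d : ℝ)) := by
    have := Nat.ceil_lt_add_one hr.le
    have e : (t / η) ^ (1 / (d : ℝ)) = (1 / η) ^ (1 / (d : ℝ)) * t ^ (1 / (d : ℝ)) := by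
      rw [← Real.mul_rpow (by positivity) ht0.le]
      congr 1
      ring
    rw [hN, hC]
    push_cast
    rw [add_mul, ← e]
    linarith
  set u := t ^ (1 - 2 / (d : ℝ)) with hu
  have hu1 : 1 ≤ u := by
    apply Real.one_le_rpow ht.le
    rw [sub_nonneg, div_le_one (by positivity)]
    linarith
  have hNd : t ≤ η * (N : ℝ) ^ d := by
    have h1 := pow_le_pow_left₀ hr.le hN1 d
    rw [← Real.rpow_natCast, ← Real.rpow_mul (by positivity), one_div,
      inv_mul_cancel₀ (by positivity), Real.rpow_one, div_le_iff₀ hη] at h1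
    linarith
  have hNu : (N : ℝ) ^ (d - 2) ≤ C ^ (d - 2) * u := by
    have h1 := pow_le_pow_left₀ (by positivity) hN3 (d - 2)
    refine h1.trans_eq ?_
    rw [mul_pow, ← Real.rpow_natCast (t ^ _), ← Real.rpow_mul ht0.le, hu]
    congr 2
    rw [Nat.cast_sub (by omega)]
    push_cast
    field_simp
  refine ⟨N ^ d, le_trans ?_ (key N t hN2 ht0.le hNd)⟩
  conv_rhs => rw [← Real.exp_log hη]
  rw [← Real.exp_add]
  apply Real.exp_le_exp.mpr
  have h1 : 4 * k * (N : ℝ) ^ (d - 2) ≤ 4 * k * (C ^ (d - 2) * u) := by gcongr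
  have h2 : |Real.log η| ≤ |Real.log η| * u := le_mul_of_one_le_right (abs_nonneg _) hu1
  linarith [neg_abs_le (Real.log η)]

/-! ### Transfer to an abstract probability space -/

theorem vec_injective : Function.Injective (vec (d := d)) := by
  rintro ⟨i, a⟩ ⟨j, b⟩ h
  have h1 := congrFun h i
  have h2 : i = j := by
    by_contra hne
    simp only [vec, Pi.single_eq_same, Pi.single_eq_of_ne hne] at h1
    split_ifs at h1 <;> omega
  subst h2
  simp only [vec, Pi.single_eq_same] at h1
  cases a
  · cases b <;> simp_all
  · cases b <;> simp_all

theorem exists_vec_eq_iff {v : Fin d → ℤ} :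
    (∃ e, vec e = v) ↔ ∃ j : Fin d, v = Pi.single j 1 ∨ v = Pi.single j (-1) := by
  constructor
  · rintro ⟨⟨j, b⟩, rfl⟩
    cases b
    · exact ⟨j, Or.inr (by simp [vec])⟩
    · exact ⟨j, Or.inl (by simp [vec])⟩
  · rintro ⟨j, rfl | rfl⟩
    · exact ⟨(j, true), by simp [vec]⟩
    · exact ⟨(j, false), by simp [vec]⟩

theorem pos_eq_add_sum {g : ℕ → Fin d → ℤ} {l : List (Step d)} {j : ℕ} (x : Fin d → ℤ)
    (hj : j ≤ l.length) (h : ∀ (m : ℕ) (hm : m < l.length), g m = vec l[m]) :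
    pos x l j = x + ∑ m ∈ Finset.range j, g m := by
  induction j generalizing x l g with
  | zero => simp [pos_zero]
  | succ j ih =>
    cases l with
    | nil => simp at hj
    | cons e l =>
      have h0 : g 0 = vec e := h 0 (by simp)
      rw [pos, ih (g := fun m => g (m + 1)) _ (by simpa using hj)
        (fun m hm => h (m + 1) (by simpa using hm)), Finset.sum_range_succ', h0]
      abel

section Measure

variable {Ω : Type*} [MeasurableSpace Ω] {P : Measure Ω}

/-- The law of `f` is uniform on the unit steps. -/
def IsUnifStep (P : Measure Ω) (f : Ω → Fin d → ℤ) : Prop :=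
  ∀ v, P {ω | f ω = v} =
    if ∃ j : Fin d, v = Pi.single j 1 ∨ v = Pi.single j (-1) then (1 : ℝ≥0∞) / (2 * d) else 0

theorem IsUnifStep.measure_eq {f : Ω → Fin d → ℤ} (hf : IsUnifStep P f) (e : Step d) :
    P {ω | f ω = vec e} = ((2 * d : ℕ) : ℝ≥0∞)⁻¹ := by
  rw [hf, if_pos (exists_vec_eq_iff.mp ⟨e, rfl⟩), one_div]
  push_cast
  rfl

theorem IsUnifStep.ae_exists {f : Ω → Fin d → ℤ} (hf : IsUnifStep P f) :
    ∀ᵐ ω ∂P, ∃ e, f ω = vec e := by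
  rw [ae_iff]
  have : {ω | ¬∃ e, f ω = vec e} ⊆
      ⋃ v : {v : Fin d → ℤ // ¬∃ e, vec e = v}, {ω | f ω = v.1} := by
    intro ω hω
    exact mem_iUnion.mpr ⟨⟨f ω, fun ⟨e, he⟩ => hω ⟨e, he.symm⟩⟩, rfl⟩
  refine measure_mono_null this (measure_iUnion_null fun v => ?_)
  rw [hf, if_neg]
  exact fun h => v.2 (exists_vec_eq_iff.mpr h)

variable [IsProbabilityMeasure P]

theorem nullMeasurableSet_of_add_compl_le {A : Set Ω} (h : P A + P Aᶜ ≤ 1) :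
    NullMeasurableSet A P := by
  set B := toMeasurable P A
  set C := toMeasurable P Aᶜ
  have hB : MeasurableSet B := measurableSet_toMeasurable _ _
  have hU : B ∪ C = univ := by
    refine eq_univ_of_forall fun ω => ?_
    by_cases hω : ω ∈ A
    · exact Or.inl (subset_toMeasurable _ _ hω)
    · exact Or.inr (subset_toMeasurable _ _ hω)
  have h1 := measure_union_add_inter (μ := P) B (measurableSet_toMeasurable P Aᶜ)
  rw [hU, measure_univ, measure_toMeasurable, measure_toMeasurable] at h1
  have h2 : P (B ∩ C) = 0 := by
    have h3 : 1 + P (B ∩ C) ≤ 1 + 0 := by rw [add_zero]; exact h1.trans_le h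
    exact le_antisymm ((ENNReal.add_le_add_iff_left ENNReal.one_ne_top).mp h3) zero_le
  refine NullMeasurableSet.congr hB.nullMeasurableSet ?_
  have h3 : B ≤ᵐ[P] A := by
    rw [ae_le_set]
    have h4 : B \ A ⊆ B ∩ C := fun ω hω => ⟨hω.1, subset_toMeasurable P Aᶜ hω.2⟩
    exact measure_mono_null h4 h2
  exact h3.antisymm (LE.le.eventuallyLE (subset_toMeasurable P A))

theorem IsUnifStep.nullMeasurableSet {f : Ω → Fin d → ℤ} (hf : IsUnifStep P f) (hd : 0 < d)
    (e : Step d) : NullMeasurableSet {ω | f ω = vec e} P := by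
  refine nullMeasurableSet_of_add_compl_le ?_
  have h1 : P {ω | f ω = vec e}ᶜ ≤ ∑ e' ∈ Finset.univ.erase e, P {ω | f ω = vec e'} := by
    refine le_trans (measure_mono_ae ?_) (measure_biUnion_finset_le _ _)
    filter_upwards [hf.ae_exists] with ω ⟨e', he'⟩ hω
    refine mem_biUnion (x := e') ?_ he'
    simp only [Finset.coe_erase, Finset.coe_univ, mem_sdiff, mem_univ, mem_singleton_iff, true_and]
    rintro rfl
    exact hω he'
  calc _ ≤ P {ω | f ω = vec e} + ∑ e' ∈ Finset.univ.erase e, P {ω | f ω = vec e'} := by gcongr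
    _ = ∑ e', P {ω | f ω = vec e'} :=
        Finset.add_sum_erase Finset.univ (fun e => P {ω | f ω = vec e}) (Finset.mem_univ e)
    _ = ((2 * d : ℕ) : ℝ≥0∞) * ((2 * d : ℕ) : ℝ≥0∞)⁻¹ := by
        simp only [hf.measure_eq, Finset.sum_const, Finset.card_univ, nsmul_eq_mul]
        congr 2
        simp [mul_comm]
    _ = 1 := ENNReal.mul_inv_cancel (by simp; omega) (ENNReal.natCast_ne_top _)
    _ ≤ 1 := le_rfl

variable {k r n : ℕ} {X : Fin k → ℕ → Ω → Fin d → ℤ}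

theorem measure_exists_steps (hd : 0 < d) (hX : ∀ i m, IsUnifStep P (X i m))
    (hindep : ∀ (s : Finset (Fin k × ℕ)) (v : Fin k × ℕ → (Fin d → ℤ)),
      P (⋂ p ∈ s, {ω | X p.1 p.2 ω = v p}) = ∏ p ∈ s, P {ω | X p.1 p.2 ω = v p})
    {σ : Fin r → Fin k} (hσ : Function.Injective σ) (S : Finset (Fin r → Fin n → Step d)) :
    P {ω | ∃ V ∈ S, ∀ i m, X (σ i) (m : Fin n) ω = vec (V i m)} =
      S.card * (((2 * d : ℕ) : ℝ≥0∞)⁻¹ ^ n) ^ r := by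
  let E : (Fin r → Fin n → Step d) → Set Ω := fun V =>
    {ω | ∀ i m, X (σ i) (m : Fin n) ω = vec (V i m)}
  let J : Fin r × Fin n → Fin k × ℕ := fun p => (σ p.1, p.2)
  have hJ : Function.Injective J := by
    rintro ⟨i, m⟩ ⟨i', m'⟩ h
    simp only [J, Prod.mk.injEq] at h
    exact Prod.ext (hσ h.1) (Fin.ext h.2)
  have hE : ∀ V, P (E V) = (((2 * d : ℕ) : ℝ≥0∞)⁻¹ ^ n) ^ r := by
    intro V
    let w : Fin k × ℕ → Fin d → ℤ := Function.extend J (fun p => vec (V p.1 p.2)) 0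
    have hw : ∀ p, w (J p) = vec (V p.1 p.2) := fun p => hJ.extend_apply _ _ p
    have h1 : E V = ⋂ p ∈ Finset.univ.image J, {ω | X p.1 p.2 ω = w p} := by
      ext ω
      simp only [E, mem_ofPred_eq, mem_iInter, Finset.mem_image, Finset.mem_univ, true_and]
      constructor
      · rintro h _ ⟨p, rfl⟩
        rw [hw]
        exact h p.1 p.2
      · intro h i m
        have := h (J (i, m)) ⟨_, rfl⟩
        rwa [hw] at this
    rw [h1, hindep, Finset.prod_image (fun a _ b _ h => hJ h)]
    simp_rw [hw]
    simp only [J, (hX _ _).measure_eq, Finset.prod_const, Finset.card_univ, Fintype.card_prod,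
      Fintype.card_fin]
    rw [mul_comm r n, pow_mul]
  have hS : {ω | ∃ V ∈ S, ∀ i m, X (σ i) (m : Fin n) ω = vec (V i m)} = ⋃ V ∈ S, E V := by
    ext ω
    simp [E]
  rw [hS, measure_biUnion_finset₀]
  · simp [hE]
  · intro V _ W _ hVW
    refine Disjoint.aedisjoint (disjoint_left.mpr fun ω hV hW => hVW ?_)
    ext1 i
    ext1 m
    exact vec_injective ((hV i m).symm.trans (hW i m))
  · intro V _
    have : E V = ⋂ i, ⋂ m : Fin n, {ω | X (σ i) m ω = vec (V i m)} := by
      ext ω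
      simp [E]
    rw [this]
    exact NullMeasurableSet.iInter fun i => NullMeasurableSet.iInter fun m =>
      (hX _ _).nullMeasurableSet hd _

/-- The walks `X i` for `i` in the range of `σ` have more than `t` points in common during
their first `n` steps. -/
def meetEvent (X : Fin k → ℕ → Ω → Fin d → ℤ) (σ : Fin r → Fin k) (n : ℕ) (t : ℝ) : Set Ω :=
  {ω | ∃ A : Finset (Fin d → ℤ), t < (A.card : ℝ) ∧
    ∀ z ∈ A, ∀ i, ∃ j ≤ n, ∑ m ∈ Finset.range j, X (σ i) m ω = z}

theorem measure_meetEvent (hd : 0 < d) (hX : ∀ i m, IsUnifStep P (X i m))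
    (hindep : ∀ (s : Finset (Fin k × ℕ)) (v : Fin k × ℕ → (Fin d → ℤ)),
      P (⋂ p ∈ s, {ω | X p.1 p.2 ω = v p}) = ∏ p ∈ s, P {ω | X p.1 p.2 ω = v p})
    {σ : Fin r → Fin k} (hσ : Function.Injective σ) (n : ℕ) (t : ℝ) :
    P (meetEvent X σ n t) = ENNReal.ofReal (manyCount d r n t / ((2 * d) ^ n) ^ r) := by
  let S : Finset (Fin r → Fin n → Step d) := Finset.univ.filter fun V =>
    ∃ A : Finset (Fin d → ℤ), t < (A.card : ℝ) ∧
      ∀ z ∈ A, ∀ i, z ∈ rng 0 (List.ofFn (V i))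
  have h1 : manyCount d r n t = S.card := by
    rw [manyCount, Finset.sum_boole]
  have h2 : ∀ ω (V : Fin r → Fin n → Step d), (∀ i m, X (σ i) (m : Fin n) ω = vec (V i m)) →
      (ω ∈ meetEvent X σ n t ↔ V ∈ S) := by
    intro ω V hV
    have h3 : ∀ z i, z ∈ rng 0 (List.ofFn (V i)) ↔
        ∃ j ≤ n, ∑ m ∈ Finset.range j, X (σ i) m ω = z := by
      intro z i
      rw [mem_rng, List.length_ofFn]
      refine exists_congr fun j => and_congr_right fun hj => ?_
      rw [pos_eq_add_sum (g := fun m => X (σ i) m ω) 0 (by simpa using hj), zero_add]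
      intro m hm
      rw [List.getElem_ofFn]
      exact hV i ⟨m, by simpa using hm⟩
    simp only [meetEvent, mem_ofPred_eq, S, Finset.mem_filter, Finset.mem_univ, true_and, h3]
  have h4 : meetEvent X σ n t =ᵐ[P]
      {ω | ∃ V ∈ S, ∀ i m, X (σ i) (m : Fin n) ω = vec (V i m)} := by
    have hae : ∀ᵐ ω ∂P, ∀ i m, ∃ e, X i m ω = vec e :=
      ae_all_iff.mpr fun i => ae_all_iff.mpr fun m => (hX i m).ae_exists
    filter_upwards [hae] with ω hω
    choose e he using hω
    refine propext ⟨fun h => ?_, fun ⟨V, hVS, hV⟩ => (h2 ω V hV).mpr hVS⟩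
    refine ⟨fun i m => e (σ i) m, ?_, fun i m => he _ _⟩
    exact (h2 ω _ fun i m => he _ _).mp h
  rw [measure_congr h4, measure_exists_steps hd hX hindep hσ, h1, div_eq_mul_inv,
    ENNReal.ofReal_mul (by positivity), ENNReal.ofReal_natCast,
    ENNReal.ofReal_inv_of_pos (by positivity), ENNReal.ofReal_pow (by positivity),
    ENNReal.ofReal_pow (by positivity), ENNReal.inv_pow, ENNReal.inv_pow]
  congr 4
  rw [← ENNReal.ofReal_natCast]
  push_cast
  rfl

end Measure

theorem manyCount_two (n : ℕ) (t : ℝ) :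
    manyCount d 2 n t / ((2 * d) ^ n) ^ 2 =
      avg n (fun l' => avg n fun l =>
        if t < ((rng (0 : Fin d → ℤ) l ∩ rng 0 l').card : ℝ) then (1 : ℝ) else 0) := by
  simp_rw [avg_eq_sum]
  rw [← Finset.sum_div, div_div, ← sq, ← Fintype.sum_prod_type']
  congr 1
  refine Fintype.sum_equiv (finTwoArrowEquiv _) _ _ fun V => ?_
  congr 1
  refine propext ⟨fun ⟨A, hA, h⟩ => hA.trans_le ?_, fun h => ⟨_, h, fun z hz i => ?_⟩⟩
  · exact_mod_cast Finset.card_le_card fun z hz => Finset.mem_inter.mpr ⟨h z hz 1, h z hz 0⟩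
  · rw [Finset.mem_inter] at hz
    fin_cases i
    · exact hz.2
    · exact hz.1

section Events

variable {Ω : Type*} {k r : ℕ} {X : Fin k → ℕ → Ω → Fin d → ℤ}

theorem bigCard_of_finset {α : Type*} {S : Set α} {t : ℝ} {A : Finset α} (hA : ↑A ⊆ S)
    (ht : t < (A.card : ℝ)) : BigCard S t := by
  by_cases h : S.Infinite
  · exact Or.inl h
  · refine Or.inr (ht.trans_le ?_)
    rw [← ncard_coe_finset]
    exact_mod_cast ncard_le_ncard hA (not_infinite.mp h)

theorem BigCard.exists_finset {α : Type*} {S : Set α} {t : ℝ} (h : BigCard S t) :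
    ∃ A : Finset α, ↑A ⊆ S ∧ t < (A.card : ℝ) := by
  by_cases hS : S.Infinite
  · obtain ⟨m, hm⟩ := exists_nat_gt t
    obtain ⟨A, hA, hc⟩ := hS.exists_subset_card_eq m
    exact ⟨A, hA, by rwa [hc]⟩
  · have hf := not_infinite.mp hS
    refine ⟨hf.toFinset, by simp, ?_⟩
    rw [← ncard_eq_toFinset_card S hf]
    exact h.resolve_left hS

theorem meetEvent_id_subset (n : ℕ) (t : ℝ) :
    meetEvent X id n t ⊆ {ω | BigCard (⋂ i, walkRange (X i) ω) t} := by
  rintro ω ⟨A, hA, h⟩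
  refine bigCard_of_finset (A := A) (fun z hz => mem_iInter.mpr fun i => ?_) hA
  obtain ⟨j, -, hj⟩ := h z hz i
  exact ⟨j, hj⟩

theorem meetEvent_mono (σ : Fin r → Fin k) (t : ℝ) : Monotone fun n => meetEvent X σ n t :=
  fun _ _ hnm _ ⟨A, hA, h⟩ => ⟨A, hA, fun z hz i =>
    let ⟨j, hj, e⟩ := h z hz i
    ⟨j, hj.trans hnm, e⟩⟩

theorem bigCard_subset_iUnion (σ : Fin r → Fin k) (t : ℝ) (M : ℕ) :
    {ω | BigCard (⋂ i, walkRange (X i) ω) t} ⊆ ⋃ n, meetEvent X σ (M + n) t := by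
  intro ω hω
  obtain ⟨A, hA, ht⟩ := BigCard.exists_finset hω
  have h1 : ∀ z i, ∃ j, z ∈ A → ∑ m ∈ Finset.range j, X (σ i) m ω = z := by
    intro z i
    by_cases hz : z ∈ A
    · obtain ⟨j, hj⟩ := mem_iInter.mp (hA hz) (σ i)
      exact ⟨j, fun _ => hj⟩
    · exact ⟨0, fun h => absurd h hz⟩
  choose j hj using h1
  refine mem_iUnion.mpr ⟨A.sup fun z => Finset.univ.sup (j z), A, ht, fun z hz i =>
    ⟨j z i, le_trans ?_ (Nat.le_add_left _ _), hj z i hz⟩⟩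
  exact (Finset.le_sup (f := j z) (Finset.mem_univ i)).trans
    (Finset.le_sup (f := fun z => Finset.univ.sup (j z)) hz)

end Events

end SRW

/-- **Theorem (intersection of k SRW ranges, d ≥ 5).** Let `d ≥ 5`, `k ≥ 2`, and let
`R_∞^1, …, R_∞^k` be the ranges of `k` independent simple random walks on `ℤ^d` started
at `0`. Then there are `c₁, c₂ > 0` such that for every `t > 1`,
`exp(−c₁ t^{1−2/d}) ≤ P(|R_∞^1 ∩ ⋯ ∩ R_∞^k| > t) ≤ exp(−c₂ t^{1−2/d})`. -/
theorem srw_ranges_intersection_tail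
    (d k : ℕ) (hd : 5 ≤ d) (hk : 2 ≤ k)
    {Ω : Type*} [MeasurableSpace Ω] (P : Measure Ω) [IsProbabilityMeasure P]
    (X : Fin k → ℕ → Ω → (Fin d → ℤ))
    (hunif : ∀ (i : Fin k) (n : ℕ) (v : Fin d → ℤ),
      P {ω | X i n ω = v} =
        if ∃ j : Fin d, v = Pi.single j 1 ∨ v = Pi.single j (-1) then
          (1 : ℝ≥0∞) / (2 * d) else 0)
    (hindep : ∀ (s : Finset (Fin k × ℕ)) (v : Fin k × ℕ → (Fin d → ℤ)),
      P (⋂ p ∈ s, {ω | X p.1 p.2 ω = v p}) = ∏ p ∈ s, P {ω | X p.1 p.2 ω = v p}) :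
    ∃ c₁ > 0, ∃ c₂ > 0, ∀ t : ℝ, 1 < t →
      ENNReal.ofReal (Real.exp (-(c₁ * t ^ (1 - 2 / (d : ℝ))))) ≤
        P {ω | BigCard (⋂ i, walkRange (X i) ω) t} ∧
      P {ω | BigCard (⋂ i, walkRange (X i) ω) t} ≤
        ENNReal.ofReal (Real.exp (-(c₂ * t ^ (1 - 2 / (d : ℝ))))) := by
  have hX : ∀ i m, SRW.IsUnifStep P (X i m) := hunif
  obtain ⟨c₁, hc₁, hlow⟩ := SRW.exp_le_manyCount hd (show 1 ≤ k by omega)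
  obtain ⟨M, c₂, hc₂, hup⟩ := SRW.avg_inter_le_exp hd
  refine ⟨c₁, hc₁, c₂, hc₂, fun t ht => ⟨?_, ?_⟩⟩
  · obtain ⟨n, hn⟩ := hlow t ht
    calc _ ≤ P (SRW.meetEvent X id n t) := by
          rw [SRW.measure_meetEvent (by omega) hX hindep Function.injective_id]
          exact ENNReal.ofReal_le_ofReal hn
      _ ≤ _ := measure_mono (SRW.meetEvent_id_subset n t)
  · have hσ := Fin.castLE_injective hk
    have hmono : Monotone fun n => SRW.meetEvent X (Fin.castLE hk) (M + n) t :=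
      fun _ _ h => SRW.meetEvent_mono _ t (Nat.add_le_add_left h M)
    refine (measure_mono (SRW.bigCard_subset_iUnion (Fin.castLE hk) t M)).trans ?_
    rw [hmono.measure_iUnion]
    refine iSup_le fun n => ?_
    rw [SRW.measure_meetEvent (by omega) hX hindep hσ, SRW.manyCount_two]
    exact ENNReal.ofReal_le_ofReal (hup n t ht)
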